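/- arXiv:math/0611197 — 6 statements merged into one kernel-verified Lean document; each statement's English description precedes it below -/
import Mathlib

section
/- Let α>0. Define φ_α(ξ):=ξ|ξ|^α and r_α(ξ,ξ₁):=φ_α(ξ)−φ_α(ξ₁)−φ_α(ξ−ξ₁) for ξ,ξ₁∈ℝ. Then for all ξ,ξ₁∈ℝ one has (α/2^α)·|ξ_min|·|ξ_max|^α ≤ |r_α(ξ,ξ₁)| ≤ (α+1+2^{−α})·|ξ_min|·|ξ_max|^α, where |ξ_min| and |ξ_max| denote respectively the minimum and the maximum of the three numbers |ξ|, |ξ₁|, |ξ−ξ₁|. -/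
open Real

/-- Bounds for the defect of additivity of `x ↦ x ^ (α + 1)` on a unit segment. -/
theorem one_sub_rpow_sub_rpow_bounds {α t : ℝ} (hα : 0 < α) (ht : 0 ≤ t) (ht' : t ≤ 1 / 2) :
    α / 2 ^ α * t ≤ 1 - t * t ^ α - (1 - t) * (1 - t) ^ α ∧
      1 - t * t ^ α - (1 - t) * (1 - t) ^ α ≤ (α + 1) * t := by
  have hp : ∀ x : ℝ, 0 ≤ x → x ^ (α + 1) = x * x ^ α := fun x hx => by
    rw [rpow_add_one' hx (by linarith), mul_comm]
  have h2 : (0 : ℝ) < 2 ^ α := by positivity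
  have hhalf : (1 / 2 : ℝ) ^ α = 1 / 2 ^ α := by
    rw [div_rpow zero_le_one zero_le_two, one_rpow]
  constructor
  · have hconv := (convexOn_rpow (p := α + 1) (by linarith)).2
      (show (1 : ℝ) ∈ Set.Ici 0 by simp) (show (1 / 2 : ℝ) ∈ Set.Ici 0 by simp)
      (show 0 ≤ 1 - 2 * t by linarith) (show 0 ≤ 2 * t by linarith) (by ring)
    simp only [smul_eq_mul, one_rpow] at hconv
    rw [show (1 - 2 * t) * 1 + 2 * t * (1 / 2) = 1 - t by ring, hp _ (by linarith),
      hp _ (by norm_num), hhalf] at hconv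
    have htpow : t * t ^ α ≤ t * (1 / 2 ^ α) := by
      rw [← hhalf]; gcongr
    have hexp : 1 + α / 2 ≤ (2 : ℝ) ^ α := by
      rw [rpow_def_of_pos zero_lt_two]
      have := add_one_le_exp (log 2 * α)
      nlinarith [log_two_gt_d9]
    have hcoef : α / 2 ^ α ≤ 2 - 2 * (1 / 2 ^ α) := by
      rw [div_le_iff₀ h2]
      field_simp
      linarith
    nlinarith [mul_le_mul_of_nonneg_right hcoef ht]
  · have hbern := one_add_mul_self_le_rpow_one_add (s := -t) (by linarith) (p := α + 1)
      (by linarith)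
    rw [← sub_eq_add_neg, hp _ (by linarith)] at hbern
    have : 0 ≤ t * t ^ α := by positivity
    linarith

theorem rpow_add_sub_rpow_bounds_of_le {α a b : ℝ} (hα : 0 < α) (ha : 0 ≤ a) (hab : a ≤ b) :
    α / 2 ^ α * a * (a + b) ^ α ≤ (a + b) * (a + b) ^ α - a * a ^ α - b * b ^ α ∧
      (a + b) * (a + b) ^ α - a * a ^ α - b * b ^ α ≤ (α + 1) * a * (a + b) ^ α := by
  rcases (add_nonneg ha (ha.trans hab)).eq_or_lt with hs | hs
  · obtain rfl : a = 0 := by linarith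
    obtain rfl : b = 0 := by linarith
    simp
  obtain ⟨s, hs_def⟩ : ∃ s, s = a + b := ⟨_, rfl⟩
  rw [← hs_def] at hs ⊢
  obtain ⟨t, rfl⟩ : ∃ t, a = s * t := ⟨a / s, by field_simp⟩
  obtain rfl : b = s * (1 - t) := by linarith
  have ht : 0 ≤ t := nonneg_of_mul_nonneg_right ha hs
  have ht' : t ≤ 1 / 2 := by linarith [le_of_mul_le_mul_left hab hs]
  obtain ⟨hlow, hupp⟩ := one_sub_rpow_sub_rpow_bounds hα ht ht'
  rw [mul_rpow hs.le ht, mul_rpow hs.le (by linarith : 0 ≤ 1 - t)]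
  have hS : 0 ≤ s * s ^ α := by positivity
  constructor
  · linear_combination mul_le_mul_of_nonneg_left hlow hS
  · linear_combination mul_le_mul_of_nonneg_left hupp hS

theorem rpow_add_sub_rpow_bounds {α a b : ℝ} (hα : 0 < α) (ha : 0 ≤ a) (hb : 0 ≤ b) :
    α / 2 ^ α * min a b * (a + b) ^ α ≤ (a + b) * (a + b) ^ α - a * a ^ α - b * b ^ α ∧
      (a + b) * (a + b) ^ α - a * a ^ α - b * b ^ α ≤ (α + 1) * min a b * (a + b) ^ α := by
  rcases le_total a b with h | h
  · rw [min_eq_left h]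
    exact rpow_add_sub_rpow_bounds_of_le hα ha h
  · rw [min_eq_right h, add_comm a b, sub_right_comm]
    exact rpow_add_sub_rpow_bounds_of_le hα hb h

theorem abs_bounds_of_abs_eq {α a b c r m M : ℝ} (hα : 0 < α) (ha : 0 ≤ a) (hb : 0 ≤ b)
    (hc : c = a + b) (hm : m = min a b) (hM : M = c)
    (hr : |r| = |c * c ^ α - a * a ^ α - b * b ^ α|) :
    α / 2 ^ α * m * M ^ α ≤ |r| ∧ |r| ≤ (α + 1 + 2 ^ (-α)) * m * M ^ α := by
  subst hm hM hc
  obtain ⟨hlow, hupp⟩ := rpow_add_sub_rpow_bounds hα ha hb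
  have hmin : 0 ≤ min a b := le_min ha hb
  have h0 : 0 ≤ α / 2 ^ α * min a b * (a + b) ^ α := by positivity
  rw [hr, abs_of_nonneg (h0.trans hlow)]
  have hcoef : α + 1 ≤ α + 1 + (2 : ℝ) ^ (-α) := le_add_of_nonneg_right (by positivity)
  exact ⟨hlow, hupp.trans (by gcongr)⟩

/-- Lemma on the absolute value of the resonance function:
for `α > 0`, `φ_α(ξ) = ξ|ξ|^α`, `r_α(ξ,ξ₁) = φ_α(ξ) - φ_α(ξ₁) - φ_α(ξ-ξ₁)`,
we have `(α/2^α)|ξ_min||ξ_max|^α ≤ |r_α(ξ,ξ₁)| ≤ (α+1+2^{-α})|ξ_min||ξ_max|^α`. -/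
theorem abs_resonance_bounds (α : ℝ) (hα : 0 < α) (ξ ξ₁ : ℝ) :
    let φ : ℝ → ℝ := fun x => x * |x| ^ α
    let r : ℝ := φ ξ - φ ξ₁ - φ (ξ - ξ₁)
    let ξmin : ℝ := min |ξ| (min |ξ₁| |ξ - ξ₁|)
    let ξmax : ℝ := max |ξ| (max |ξ₁| |ξ - ξ₁|)
    α / 2 ^ α * ξmin * ξmax ^ α ≤ |r| ∧
      |r| ≤ (α + 1 + 2 ^ (-α)) * ξmin * ξmax ^ α := by
  intro φ r ξmin ξmax
  obtain ⟨η, hη⟩ : ∃ η, η = ξ - ξ₁ := ⟨_, rfl⟩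
  obtain rfl : ξ = ξ₁ + η := by linarith
  simp only [r, ξmin, ξmax, φ, add_sub_cancel_left]
  clear hη r ξmin ξmax φ
  have key (a b c : ℝ) (ha : 0 ≤ a) (hb : 0 ≤ b) (hc : c = a + b) :=
    abs_bounds_of_abs_eq (r := (ξ₁ + η) * |ξ₁ + η| ^ α - ξ₁ * |ξ₁| ^ α - η * |η| ^ α)
      (m := min |ξ₁ + η| (min |ξ₁| |η|)) (M := max |ξ₁ + η| (max |ξ₁| |η|)) hα ha hb hc
  rcases le_total 0 ξ₁ with h₁ | h₁ <;> rcases le_total 0 η with h₂ | h₂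
  · have h : 0 ≤ ξ₁ + η := by linarith
    apply key ξ₁ η (ξ₁ + η) h₁ h₂ rfl <;>
      simp only [abs_of_nonneg h₁, abs_of_nonneg h₂, abs_of_nonneg h]
    · grind
    · grind
  · rcases le_total 0 (ξ₁ + η) with h | h
    · apply key (ξ₁ + η) (-η) ξ₁ h (by linarith) (by ring) <;>
        simp only [abs_of_nonneg h₁, abs_of_nonpos h₂, abs_of_nonneg h]
      · grind
      · grind
      · rw [abs_eq_abs]; right; ring
    · apply key (-(ξ₁ + η)) ξ₁ (-η) (by linarith) h₁ (by ring) <;>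
        simp only [abs_of_nonneg h₁, abs_of_nonpos h₂, abs_of_nonpos h]
      · grind
      · grind
      · rw [abs_eq_abs]; left; ring
  · rcases le_total 0 (ξ₁ + η) with h | h
    · apply key (ξ₁ + η) (-ξ₁) η h (by linarith) (by ring) <;>
        simp only [abs_of_nonpos h₁, abs_of_nonneg h₂, abs_of_nonneg h]
      · grind
      · grind
      · rw [abs_eq_abs]; right; ring
    · apply key (-(ξ₁ + η)) η (-ξ₁) (by linarith) h₂ (by ring) <;>
        simp only [abs_of_nonpos h₁, abs_of_nonneg h₂, abs_of_nonpos h]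
      · grind
      · grind
      · rw [abs_eq_abs]; left; ring
  · have h : ξ₁ + η ≤ 0 := by linarith
    apply key (-ξ₁) (-η) (-(ξ₁ + η)) (by linarith) (by linarith) (by ring) <;>
      simp only [abs_of_nonpos h₁, abs_of_nonpos h₂, abs_of_nonpos h]
    · grind
    · grind
    · rw [abs_eq_abs]; right; ring
end

section
/- Let α>0 and let τ,τ₁,η,η₁∈ℝ and ξ,ξ₁∈ℝ with ξ≠0, ξ₁≠0 and ξ−ξ₁≠0. Set λ:=τ−ξ|ξ|^α+η²/ξ, λ₁:=τ₁−ξ₁|ξ₁|^α+η₁²/ξ₁, λ₂:=(τ−τ₁)−(ξ−ξ₁)|ξ−ξ₁|^α+(η−η₁)²/(ξ−ξ₁), and ν:=ξ|ξ|^α−ξ₁|ξ₁|^α−(ξ−ξ₁)|ξ−ξ₁|^α. Then the resonance identity λ₁+λ₂−λ = ν + (ξη₁−ηξ₁)²/(ξ·ξ₁·(ξ−ξ₁)) holds. -/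
open Real

/-- The resonance identity
`λ₁ + λ₂ - λ = ν + (ξη₁ - ηξ₁)² / (ξ ξ₁ (ξ - ξ₁))`
where `λ(τ,ξ,η) = τ - ξ|ξ|^α + η²/ξ` and
`ν = ξ|ξ|^α - ξ₁|ξ₁|^α - (ξ-ξ₁)|ξ-ξ₁|^α`. -/
theorem resonance_identity (α : ℝ) (hα : 0 < α) (τ τ₁ η η₁ ξ ξ₁ : ℝ)
    (hξ : ξ ≠ 0) (hξ₁ : ξ₁ ≠ 0) (hξξ₁ : ξ - ξ₁ ≠ 0) :
    let lam : ℝ → ℝ → ℝ → ℝ := fun τ' ξ' η' => τ' - ξ' * |ξ'| ^ α + η' ^ 2 / ξ'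
    let ν : ℝ := ξ * |ξ| ^ α - ξ₁ * |ξ₁| ^ α - (ξ - ξ₁) * |ξ - ξ₁| ^ α
    lam τ₁ ξ₁ η₁ + lam (τ - τ₁) (ξ - ξ₁) (η - η₁) - lam τ ξ η
      = ν + (ξ * η₁ - η * ξ₁) ^ 2 / (ξ * ξ₁ * (ξ - ξ₁)) := by
  intro lam ν
  have key : η₁ ^ 2 / ξ₁ + (η - η₁) ^ 2 / (ξ - ξ₁) - η ^ 2 / ξ
      = (ξ * η₁ - η * ξ₁) ^ 2 / (ξ * ξ₁ * (ξ - ξ₁)) := by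
    field_simp
    ring
  simp only [lam, ν]
  linear_combination key
end

section
/- Let α>0 and ξ,ξ₁∈ℝ with ξ·ξ₁·(ξ−ξ₁)≠0. Then r_α(ξ,ξ₁):=ξ|ξ|^α−ξ₁|ξ₁|^α−(ξ−ξ₁)|ξ−ξ₁|^α has the same strict sign as ξ·ξ₁·(ξ−ξ₁); that is, r_α(ξ,ξ₁)·ξ·ξ₁·(ξ−ξ₁) > 0. (Consequently, in the resonance identity λ₁+λ₂−λ = r_α(ξ,ξ₁) + (ξη₁−ηξ₁)²/(ξξ₁(ξ−ξ₁)) the two terms on the right-hand side always have the same sign.) -/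
open Real

/-- The function `x ↦ x * x ^ α` is strictly superadditive on the positive reals. -/
theorem mul_rpow_add_lt {α a b : ℝ} (hα : 0 < α) (ha : 0 < a) (hb : 0 < b) :
    a * a ^ α + b * b ^ α < (a + b) * (a + b) ^ α := by
  have h₁ : a ^ α < (a + b) ^ α := rpow_lt_rpow ha.le (by linarith) hα
  have h₂ : b ^ α < (a + b) ^ α := rpow_lt_rpow hb.le (by linarith) hα
  rw [add_mul]
  gcongr

/-- For `α > 0` and `ξ ξ₁` with `ξ·ξ₁·(ξ-ξ₁) ≠ 0`, the resonance function
`r_α(ξ,ξ₁) = ξ|ξ|^α - ξ₁|ξ₁|^α - (ξ-ξ₁)|ξ-ξ₁|^α` has the same strict sign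
as `ξ·ξ₁·(ξ-ξ₁)`. -/
theorem resonance_sign (α : ℝ) (hα : 0 < α) (ξ ξ₁ : ℝ)
    (h : ξ * ξ₁ * (ξ - ξ₁) ≠ 0) :
    (ξ * |ξ| ^ α - ξ₁ * |ξ₁| ^ α - (ξ - ξ₁) * |ξ - ξ₁| ^ α) *
      ξ * ξ₁ * (ξ - ξ₁) > 0 := by
  have hξ : ξ ≠ 0 := by rintro rfl; simp at h
  have hξ₁ : ξ₁ ≠ 0 := by rintro rfl; simp at h
  have hsub : ξ - ξ₁ ≠ 0 := right_ne_zero_of_mul h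
  obtain ⟨ζ, rfl⟩ : ∃ ζ, ξ = ξ₁ + ζ := ⟨ξ - ξ₁, by ring⟩
  rw [add_sub_cancel_left] at hsub ⊢
  rw [mul_assoc, mul_assoc]
  rcases hξ₁.lt_or_gt with h₁ | h₁ <;> rcases hsub.lt_or_gt with h₂ | h₂
  · have key := mul_rpow_add_lt hα (neg_pos.2 h₁) (neg_pos.2 h₂)
    have h₀ : ξ₁ + ζ < 0 := add_neg h₁ h₂
    rw [← neg_add] at key
    rw [abs_of_neg h₀, abs_of_neg h₁, abs_of_neg h₂]
    exact mul_pos_of_neg_of_neg (by linarith)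
      (mul_neg_of_neg_of_pos h₀ (mul_pos_of_neg_of_neg h₁ h₂))
  · rcases hξ.lt_or_gt with h₀ | h₀
    · have key := mul_rpow_add_lt hα (neg_pos.2 h₀) h₂
      rw [show -(ξ₁ + ζ) + ζ = -ξ₁ by ring] at key
      rw [abs_of_neg h₀, abs_of_neg h₁, abs_of_pos h₂]
      exact mul_pos (by linarith) (mul_pos_of_neg_of_neg h₀ (mul_neg_of_neg_of_pos h₁ h₂))
    · have key := mul_rpow_add_lt hα h₀ (neg_pos.2 h₁)
      rw [show ξ₁ + ζ + -ξ₁ = ζ by ring] at key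
      rw [abs_of_pos h₀, abs_of_neg h₁, abs_of_pos h₂]
      exact mul_pos_of_neg_of_neg (by linarith)
        (mul_neg_of_pos_of_neg h₀ (mul_neg_of_neg_of_pos h₁ h₂))
  · rcases hξ.lt_or_gt with h₀ | h₀
    · have key := mul_rpow_add_lt hα (neg_pos.2 h₀) h₁
      rw [show -(ξ₁ + ζ) + ξ₁ = -ζ by ring] at key
      rw [abs_of_neg h₀, abs_of_pos h₁, abs_of_neg h₂]
      exact mul_pos (by linarith) (mul_pos_of_neg_of_neg h₀ (mul_neg_of_pos_of_neg h₁ h₂))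
    · have key := mul_rpow_add_lt hα h₀ (neg_pos.2 h₂)
      rw [show ξ₁ + ζ + -ζ = ξ₁ by ring] at key
      rw [abs_of_pos h₀, abs_of_pos h₁, abs_of_neg h₂]
      exact mul_pos_of_neg_of_neg (by linarith)
        (mul_neg_of_pos_of_neg h₀ (mul_neg_of_pos_of_neg h₁ h₂))
  · have key := mul_rpow_add_lt hα h₁ h₂
    have h₀ : 0 < ξ₁ + ζ := add_pos h₁ h₂
    rw [abs_of_pos h₀, abs_of_pos h₁, abs_of_pos h₂]
    exact mul_pos (by linarith) (mul_pos h₀ (mul_pos h₁ h₂))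
end

section
/- Let α>0 and let τ,τ₁,η,η₁∈ℝ and ξ,ξ₁∈ℝ with ξ≠0, ξ₁≠0 and ξ−ξ₁≠0. Set λ:=τ−ξ|ξ|^α+η²/ξ, λ₁:=τ₁−ξ₁|ξ₁|^α+η₁²/ξ₁, λ₂:=(τ−τ₁)−(ξ−ξ₁)|ξ−ξ₁|^α+(η−η₁)²/(ξ−ξ₁), and ν:=ξ|ξ|^α−ξ₁|ξ₁|^α−(ξ−ξ₁)|ξ−ξ₁|^α. Then max(|λ|,|λ₁|,|λ₂|) ≥ (1/3)|λ₁+λ₂−λ| ≥ (1/3)|ν| ≥ (α/(3·2^α))·|ξ_min|·|ξ_max|^α, where |ξ_min| and |ξ_max| denote the minimum and maximum of |ξ|, |ξ₁|, |ξ−ξ₁|. -/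
open Real

/-- Normalized two-term lower bound: the resonance for frequencies `u ≥ v` with `u + v = 1`. -/
lemma resonance_lower_bound_normalized {α u v : ℝ} (hα : 0 < α) (hv : 0 < v) (hvu : v ≤ u)
    (huv : u + v = 1) :
    α / 2 ^ α * v ≤ 1 - u * u ^ α - v * v ^ α := by
  have hu : 0 < u := hv.trans_le hvu
  have hhalf : v ^ α ≤ (1 / 2 : ℝ) ^ α := rpow_le_rpow hv.le (by linarith) hα.le
  have hinv : α / 2 ^ α = α * (1 / 2 : ℝ) ^ α := by
    rw [div_rpow zero_le_one zero_le_two, one_rpow]; ring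
  have hv' := mul_le_mul_of_nonneg_left hhalf hv.le
  rw [hinv]
  rcases le_total α 1 with h1 | h1
  · have hbern : ∀ z : ℝ, 0 ≤ z → z ^ α ≤ 1 + α * (z - 1) := fun z hz => by
      have := rpow_one_add_le_one_add_mul_self (s := z - 1) (by linarith) hα.le h1
      simpa using this
    have hu' := mul_le_mul_of_nonneg_left (hbern u hu.le) hu.le
    have hb := hbern (1 / 2) (by norm_num)
    have key : (1 / 2 : ℝ) ^ α * (1 + α) ≤ 1 + α / 2 := by nlinarith [sq_nonneg α]
    have huhalf : α * v * (1 / 2) ≤ α * v * u := by gcongr; linarith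
    have hv1 : v = 1 - u := by linarith
    subst hv1
    nlinarith [mul_le_mul_of_nonneg_left key hv.le]
  · have hbern := one_add_mul_self_le_rpow_one_add (s := 1) (by norm_num) h1
    have hmul : (1 / 2 : ℝ) ^ α * 2 ^ α = 1 := by
      rw [← mul_rpow (by norm_num) (by norm_num)]; norm_num
    have key : (1 / 2 : ℝ) ^ α * (1 + α) ≤ 1 := by
      calc (1 / 2 : ℝ) ^ α * (1 + α) ≤ (1 / 2 : ℝ) ^ α * 2 ^ α := by
            gcongr
            norm_num at hbern
            exact hbern
        _ = 1 := hmul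
    have hu1 : u * u ^ α ≤ u :=
      mul_le_of_le_one_right hu.le (rpow_le_one hu.le (by linarith) hα.le)
    nlinarith [mul_le_mul_of_nonneg_left key hv.le]

/-- Lower bound for the resonance function of two positive frequencies. -/
lemma resonance_lower_bound {α x y : ℝ} (hα : 0 < α) (hx : 0 < x) (hy : 0 < y) :
    α / 2 ^ α * min x y * (x + y) ^ α ≤
      (x + y) * (x + y) ^ α - x * x ^ α - y * y ^ α := by
  wlog h : y ≤ x generalizing x y
  · have := this hy hx (le_of_not_ge h)
    rw [min_comm, add_comm y x] at this
    linarith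
  have hs : 0 < x + y := by positivity
  have hn := resonance_lower_bound_normalized (u := x / (x + y)) (v := y / (x + y)) hα
    (by positivity) (by gcongr) (by field_simp)
  rw [div_rpow hx.le hs.le, div_rpow hy.le hs.le] at hn
  have hS : 0 < (x + y) ^ α := by positivity
  have hm := mul_le_mul_of_nonneg_left hn (mul_pos hs hS).le
  rw [min_eq_right h]
  generalize (x + y) ^ α = S at hm hS ⊢
  calc α / 2 ^ α * y * S = (x + y) * S * (α / 2 ^ α * (y / (x + y))) := by field_simp
    _ ≤ _ := hm
    _ = (x + y) * S - x * x ^ α - y * y ^ α := by field_simp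

/-- Up to sign, the resonance function only involves two positive frequencies, and its sign is that
of the product of the three frequencies. -/
lemma exists_pos_resonance_eq (α : ℝ) {x y : ℝ} (hx : x ≠ 0) (hy : y ≠ 0) (hxy : x + y ≠ 0) :
    ∃ p q : ℝ, 0 < p ∧ 0 < q ∧
      min |x + y| (min |x| |y|) ≤ min p q ∧ max |x + y| (max |x| |y|) = p + q ∧
      (((x + y) * |x + y| ^ α - x * |x| ^ α - y * |y| ^ α =
          (p + q) * (p + q) ^ α - p * p ^ α - q * q ^ α ∧ 0 < (x + y) * x * y) ∨
        ((x + y) * |x + y| ^ α - x * |x| ^ α - y * |y| ^ α =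
          -((p + q) * (p + q) ^ α - p * p ^ α - q * q ^ α) ∧ (x + y) * x * y < 0)) := by
  have hcase : ∀ {x y : ℝ}, 0 < x → 0 < y → 0 < (x + y) * x * y := fun h k => by positivity
  rcases lt_or_gt_of_ne hx with h1 | h1 <;> rcases lt_or_gt_of_ne hy with h2 | h2
  · refine ⟨-x, -y, by linarith, by linarith, ?_, ?_, .inr ⟨?_, ?_⟩⟩
    · rw [abs_of_neg h1, abs_of_neg h2]; exact min_le_right _ _
    · rw [abs_of_neg h1, abs_of_neg h2, abs_of_neg (add_neg h1 h2), max_eq_left]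
      · ring
      · apply max_le <;> linarith
    · rw [abs_of_neg h1, abs_of_neg h2, abs_of_neg (add_neg h1 h2), neg_add]; ring
    · linarith [hcase (neg_pos.2 h1) (neg_pos.2 h2)]
  · rcases lt_or_gt_of_ne hxy with h3 | h3
    · refine ⟨-(x + y), y, by linarith, h2, ?_, ?_, .inl ⟨?_, ?_⟩⟩
      · rw [abs_of_neg h3, abs_of_pos h2]; gcongr; exact min_le_right _ _
      · rw [abs_of_neg h1, abs_of_pos h2, abs_of_neg h3, max_eq_left (by linarith : y ≤ -x),
          max_eq_right] <;> linarith
      · rw [abs_of_neg h1, abs_of_pos h2, abs_of_neg h3, (by ring : -(x + y) + y = -x)]; ring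
      · exact mul_pos (mul_pos_of_neg_of_neg h3 h1) h2
    · refine ⟨x + y, -x, h3, by linarith, ?_, ?_, .inr ⟨?_, ?_⟩⟩
      · rw [abs_of_pos h3, abs_of_neg h1]; gcongr; exact min_le_left _ _
      · rw [abs_of_neg h1, abs_of_pos h2, abs_of_pos h3, max_eq_right (by linarith : -x ≤ y),
          max_eq_right] <;> linarith
      · rw [abs_of_neg h1, abs_of_pos h2, abs_of_pos h3, (by ring : x + y + -x = y)]; ring
      · exact mul_neg_of_neg_of_pos (mul_neg_of_pos_of_neg h3 h1) h2
  · rcases lt_or_gt_of_ne hxy with h3 | h3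
    · refine ⟨-(x + y), x, by linarith, h1, ?_, ?_, .inl ⟨?_, ?_⟩⟩
      · rw [abs_of_neg h3, abs_of_pos h1]; gcongr; exact min_le_left _ _
      · rw [abs_of_pos h1, abs_of_neg h2, abs_of_neg h3, max_eq_right (by linarith : x ≤ -y),
          max_eq_right] <;> linarith
      · rw [abs_of_pos h1, abs_of_neg h2, abs_of_neg h3, (by ring : -(x + y) + x = -y)]; ring
      · exact mul_pos_of_neg_of_neg (mul_neg_of_neg_of_pos h3 h1) h2
    · refine ⟨x + y, -y, h3, by linarith, ?_, ?_, .inr ⟨?_, ?_⟩⟩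
      · rw [abs_of_pos h3, abs_of_neg h2]; gcongr; exact min_le_right _ _
      · rw [abs_of_pos h1, abs_of_neg h2, abs_of_pos h3, max_eq_left (by linarith : -y ≤ x),
          max_eq_right] <;> linarith
      · rw [abs_of_pos h1, abs_of_neg h2, abs_of_pos h3, (by ring : x + y + -y = x)]; ring
      · exact mul_neg_of_pos_of_neg (mul_pos h3 h1) h2
  · refine ⟨x, y, h1, h2, ?_, ?_, .inl ⟨?_, hcase h1 h2⟩⟩
    · rw [abs_of_pos h1, abs_of_pos h2]; exact min_le_right _ _
    · rw [abs_of_pos h1, abs_of_pos h2, abs_of_pos (add_pos h1 h2), max_eq_left]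
      apply max_le <;> linarith
    · rw [abs_of_pos h1, abs_of_pos h2, abs_of_pos (add_pos h1 h2)]

/-- The transversal part of the resonance identity is a square over the product of the
frequencies. -/
lemma sq_div_add_sq_div_sub {x y a b : ℝ} (hx : x ≠ 0) (hy : y ≠ 0) (hxy : x + y ≠ 0) :
    a ^ 2 / x + b ^ 2 / y - (a + b) ^ 2 / (x + y) =
      (a * y - b * x) ^ 2 / ((x + y) * x * y) := by
  field_simp
  ring

/-- The chain of inequalities
`max(|λ|,|λ₁|,|λ₂|) ≥ (1/3)|λ₁+λ₂-λ| ≥ (1/3)|ν| ≥ (α/(3·2^α))|ξ_min||ξ_max|^α`. -/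
theorem lambda_max_lower_bound (α : ℝ) (hα : 0 < α) (τ τ₁ η η₁ ξ ξ₁ : ℝ)
    (hξ : ξ ≠ 0) (hξ₁ : ξ₁ ≠ 0) (hξξ₁ : ξ - ξ₁ ≠ 0) :
    let lam : ℝ → ℝ → ℝ → ℝ := fun τ' ξ' η' => τ' - ξ' * |ξ'| ^ α + η' ^ 2 / ξ'
    let lam₀ : ℝ := lam τ ξ η
    let lam₁ : ℝ := lam τ₁ ξ₁ η₁
    let lam₂ : ℝ := lam (τ - τ₁) (ξ - ξ₁) (η - η₁)
    let ν : ℝ := ξ * |ξ| ^ α - ξ₁ * |ξ₁| ^ α - (ξ - ξ₁) * |ξ - ξ₁| ^ α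
    let ξmin : ℝ := min |ξ| (min |ξ₁| |ξ - ξ₁|)
    let ξmax : ℝ := max |ξ| (max |ξ₁| |ξ - ξ₁|)
    max |lam₀| (max |lam₁| |lam₂|) ≥ 1 / 3 * |lam₁ + lam₂ - lam₀| ∧
      1 / 3 * |lam₁ + lam₂ - lam₀| ≥ 1 / 3 * |ν| ∧
      1 / 3 * |ν| ≥ α / (3 * 2 ^ α) * ξmin * ξmax ^ α := by
  intro lam lam₀ lam₁ lam₂ ν ξmin ξmax
  obtain ⟨y, rfl⟩ : ∃ y, ξ = ξ₁ + y := ⟨ξ - ξ₁, by ring⟩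
  obtain ⟨b, rfl⟩ : ∃ b, η = η₁ + b := ⟨η - η₁, by ring⟩
  have hsub : ξ₁ + y - ξ₁ = y := by ring
  have hsub' : η₁ + b - η₁ = b := by ring
  rw [hsub] at hξξ₁
  obtain ⟨p, q, hp, hq, hmin, hmax, hν⟩ := exists_pos_resonance_eq α hξ₁ hξξ₁ hξ
  have hcore := resonance_lower_bound hα hp hq
  set C := (p + q) * (p + q) ^ α - p * p ^ α - q * q ^ α
  have hC : 0 ≤ C := le_trans (by positivity) hcore
  have hsum : lam₁ + lam₂ - lam₀ = ν + (η₁ * y - b * ξ₁) ^ 2 / ((ξ₁ + y) * ξ₁ * y) := by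
    rw [← sq_div_add_sq_div_sub hξ₁ hξξ₁ hξ]
    simp only [lam₁, lam₂, lam₀, lam, ν, hsub, hsub']
    ring
  have hν' : ν = (ξ₁ + y) * |ξ₁ + y| ^ α - ξ₁ * |ξ₁| ^ α - y * |y| ^ α := by
    simp only [ν, hsub]
  rw [← hν'] at hν
  refine ⟨?_, ?_, ?_⟩
  · have h0 := le_max_left |lam₀| (max |lam₁| |lam₂|)
    have h12 := le_max_right |lam₀| (max |lam₁| |lam₂|)
    have h1 := (le_max_left |lam₁| |lam₂|).trans h12
    have h2 := (le_max_right |lam₁| |lam₂|).trans h12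
    linarith [abs_sub (lam₁ + lam₂) lam₀, abs_add_le lam₁ lam₂]
  · rw [hsum]
    refine mul_le_mul_of_nonneg_left ?_ (by norm_num)
    rcases hν with ⟨h, hs⟩ | ⟨h, hs⟩
    · have hD := div_nonneg (sq_nonneg (η₁ * y - b * ξ₁)) hs.le
      rw [abs_of_nonneg (h ▸ hC), abs_of_nonneg (by linarith)]
      linarith
    · have hD := div_nonpos_of_nonneg_of_nonpos (sq_nonneg (η₁ * y - b * ξ₁)) hs.le
      rw [abs_of_nonpos (by linarith : ν ≤ 0), abs_of_nonpos (by linarith)]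
      linarith
  · have habs : |ν| = C := by
      rcases hν with ⟨h, -⟩ | ⟨h, -⟩ <;> simp [h, abs_of_nonneg hC]
    have hmin' : ξmin ≤ min p q := by simpa only [ξmin, hsub] using hmin
    have hmax' : ξmax = p + q := by simpa only [ξmax, hsub] using hmax
    rw [habs, hmax']
    calc α / (3 * 2 ^ α) * ξmin * (p + q) ^ α
        ≤ α / (3 * 2 ^ α) * min p q * (p + q) ^ α := by gcongr
      _ = 1 / 3 * (α / 2 ^ α * min p q * (p + q) ^ α) := by field_simp
      _ ≤ 1 / 3 * C := by gcongr
end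

section
/- Let 4/3<α≤6. There exists a constant C>0 depending only on α such that for all κ∈ℝ, all δ>0, all t∈ℝ with t≠0 and all x,y∈ℝ, the absolutely convergent integral I := ∫_ℝ |ξ|^{(α−1)/2} e^{iκ·log|ξ|} e^{−δξ²} · exp(i(xξ + tξ|ξ|^α + sgn(ξ/t)·π/4 + ξy²/(4t))) dξ satisfies |I| ≤ C·⟨κ⟩·|t|^{−1/2}. -/
open Real MeasureTheory Complex

/-- One integration by parts for an oscillatory integral whose phase has no stationary point. The
error term is controlled by a majorant with explicit primitive `h`. -/
lemma norm_integral_mul_cexp_le {A B : ℝ} (hAB : A ≤ B) {a a' : ℝ → ℂ} {φ φ' φ'' h h' : ℝ → ℝ}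
    (ha : ∀ u ∈ Set.Icc A B, HasDerivAt a (a' u) u)
    (hφ : ∀ u ∈ Set.Icc A B, HasDerivAt φ (φ' u) u)
    (hφ' : ∀ u ∈ Set.Icc A B, HasDerivAt φ' (φ'' u) u)
    (hh : ∀ u ∈ Set.Icc A B, HasDerivAt h (h' u) u)
    (ha'c : ContinuousOn a' (Set.Icc A B)) (hφ''c : ContinuousOn φ'' (Set.Icc A B))
    (hh'c : ContinuousOn h' (Set.Icc A B))
    (hne : ∀ u ∈ Set.Icc A B, φ' u ≠ 0)
    (hle : ∀ u ∈ Set.Icc A B, ‖a' u‖ / |φ' u| + ‖a u‖ * |φ'' u| / φ' u ^ 2 ≤ h' u) :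
    ‖∫ u in A..B, a u * cexp (I * (φ u : ℂ))‖ ≤
      ‖a A‖ / |φ' A| + ‖a B‖ / |φ' B| + (h B - h A) := by
  set F : ℝ → ℂ := fun u => a u * cexp (I * (φ u : ℂ)) / (I * (φ' u : ℂ)) with hF
  set r : ℝ → ℂ := fun u =>
    cexp (I * (φ u : ℂ)) * (a' u / (I * φ' u) - a u * φ'' u / (I * (φ' u : ℂ) ^ 2)) with hr
  have hnorm : ∀ v : ℝ, ‖cexp (I * (v : ℂ))‖ = 1 := fun v => by
    rw [mul_comm]; exact Complex.norm_exp_ofReal_mul_I v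
  have hFd : ∀ u ∈ Set.Icc A B, HasDerivAt F (a u * cexp (I * (φ u : ℂ)) + r u) u := by
    intro u hu
    have hne' : (φ' u : ℂ) ≠ 0 := by exact_mod_cast hne u hu
    have h1 := (((hφ u hu).ofReal_comp).const_mul I).cexp
    have h2 := ((hφ' u hu).ofReal_comp).const_mul I
    have h3 := ((ha u hu).mul h1).div h2 (mul_ne_zero I_ne_zero hne')
    refine h3.congr_deriv ?_
    simp only [hr, Pi.mul_apply]
    field_simp
    ring
  have hac : ContinuousOn a (Set.Icc A B) := fun u hu => (ha u hu).continuousAt.continuousWithinAt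
  have hφc : ContinuousOn φ (Set.Icc A B) := fun u hu => (hφ u hu).continuousAt.continuousWithinAt
  have hφ'c : ContinuousOn φ' (Set.Icc A B) :=
    fun u hu => (hφ' u hu).continuousAt.continuousWithinAt
  have hec : ContinuousOn (fun u => cexp (I * (φ u : ℂ))) (Set.Icc A B) := by fun_prop
  have hrc : ContinuousOn r (Set.Icc A B) := by
    have hne' : ∀ u ∈ Set.Icc A B, (φ' u : ℂ) ≠ 0 := fun u hu => by exact_mod_cast hne u hu
    refine hec.mul (ContinuousOn.sub ?_ ?_)
    · exact ha'c.div (by fun_prop) fun u hu => mul_ne_zero I_ne_zero (hne' u hu)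
    · exact ContinuousOn.div (by fun_prop) (by fun_prop)
        fun u hu => mul_ne_zero I_ne_zero (pow_ne_zero 2 (hne' u hu))
  have hmain : IntervalIntegrable (fun u => a u * cexp (I * (φ u : ℂ))) volume A B :=
    (hac.mul hec).intervalIntegrable_of_Icc hAB
  have hri : IntervalIntegrable r volume A B := hrc.intervalIntegrable_of_Icc hAB
  have hh'i : IntervalIntegrable h' volume A B := hh'c.intervalIntegrable_of_Icc hAB
  have hFTC : ∫ u in A..B, (a u * cexp (I * (φ u : ℂ)) + r u) = F B - F A :=
    intervalIntegral.integral_eq_sub_of_hasDerivAt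
      (fun u hu => hFd u (by rwa [Set.uIcc_of_le hAB] at hu)) (hmain.add hri)
  have hhFTC : ∫ u in A..B, h' u = h B - h A :=
    intervalIntegral.integral_eq_sub_of_hasDerivAt
      (fun u hu => hh u (by rwa [Set.uIcc_of_le hAB] at hu)) hh'i
  rw [intervalIntegral.integral_add hmain hri] at hFTC
  have hrle : ‖∫ u in A..B, r u‖ ≤ h B - h A := by
    rw [← hhFTC]
    refine intervalIntegral.norm_integral_le_of_norm_le hAB ?_ hh'i
    refine Filter.Eventually.of_forall fun u hu => ?_
    refine le_trans ?_ (hle u (Set.Ioc_subset_Icc_self hu))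
    rw [hr, norm_mul, hnorm, one_mul]
    refine (norm_sub_le _ _).trans (le_of_eq ?_)
    simp
  have hFn : ∀ u, ‖F u‖ = ‖a u‖ / |φ' u| := fun u => by simp [hF, hnorm]
  have heq : ∫ u in A..B, a u * cexp (I * (φ u : ℂ)) = F B - F A - ∫ u in A..B, r u := by
    rw [← hFTC]; ring
  rw [heq]
  calc _ ≤ ‖F B‖ + ‖F A‖ + ‖∫ u in A..B, r u‖ :=
        (norm_sub_le _ _).trans (by gcongr; exact norm_sub_le _ _)
    _ ≤ _ := by rw [hFn, hFn]; linarith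

/-- Oscillatory integral over an interval at distance at least `ε` from the origin and from the
stationary point `c` of the phase. -/
lemma norm_integral_away_le {A B c t ε K : ℝ} (hAB : A ≤ B) (ht : 0 < t) (hε : 0 < ε)
    (hK : 0 ≤ K) (hA : ε ≤ A) (hc : c + ε ≤ A ∨ B ≤ c - ε)
    {a a' : ℝ → ℂ} {φ φ' φ'' : ℝ → ℝ}
    (ha : ∀ u, 0 < u → HasDerivAt a (a' u) u)
    (hφ : ∀ u, 0 < u → HasDerivAt φ (φ' u) u)
    (hφ' : ∀ u, 0 < u → HasDerivAt φ' (φ'' u) u)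
    (ha'c : ContinuousOn a' (Set.Ioi 0)) (hφ''c : ContinuousOn φ'' (Set.Ioi 0))
    (ha1 : ∀ u, 0 < u → ‖a u‖ ≤ 1) (haK : ∀ u, 0 < u → ‖a' u‖ ≤ K / u)
    (hlow : ∀ u, 0 < u → 2 * t * |u - c| ≤ |φ' u|)
    (hup : ∀ u, 0 < u → |φ'' u| ≤ 4 * t + |φ' u| / u) :
    ‖∫ u in A..B, a u * cexp (I * (φ u : ℂ))‖ ≤ (K + 5) / 2 / (t * ε) := by
  have hpos : ∀ u ∈ Set.Icc A B, 0 < u := fun u hu => by linarith [hu.1]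
  have hdist : ∀ u ∈ Set.Icc A B, ε ≤ |u - c| := by
    intro u hu
    rcases hc with h | h
    · exact le_trans (by linarith [hu.1]) (le_abs_self _)
    · exact le_trans (by linarith [hu.2]) (neg_le_abs _)
  have hne : ∀ u ∈ Set.Icc A B, u - c ≠ 0 := fun u hu h => by
    have := hdist u hu
    rw [h, abs_zero] at this
    linarith
  have hsub : Set.Icc A B ⊆ Set.Ioi 0 := fun u hu => hpos u hu
  have hφlow : ∀ u ∈ Set.Icc A B, 2 * t * ε ≤ |φ' u| := fun u hu =>
    (mul_le_mul_of_nonneg_left (hdist u hu) (by positivity)).trans (hlow u (hpos u hu))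
  set h : ℝ → ℝ := fun u => -((K + 1) / (4 * t)) * u⁻¹ - ((K + 5) / (4 * t)) * (u - c)⁻¹ with hh
  set h' : ℝ → ℝ := fun u =>
    (K + 1) / (4 * t) * (u ^ 2)⁻¹ + ((K + 5) / (4 * t)) * ((u - c) ^ 2)⁻¹ with hh'
  have key := norm_integral_mul_cexp_le (h := h) (h' := h') hAB
    (fun u hu => ha u (hpos u hu)) (fun u hu => hφ u (hpos u hu))
    (fun u hu => hφ' u (hpos u hu))
    (fun u hu => by
      have h1 := (hasDerivAt_inv (hpos u hu).ne').const_mul (-((K + 1) / (4 * t)))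
      have h2 := (((hasDerivAt_id u).sub_const c).inv (hne u hu)).const_mul ((K + 5) / (4 * t))
      refine (h1.sub h2).congr_deriv ?_
      simp only [hh', id]
      ring)
    (ha'c.mono hsub) (hφ''c.mono hsub)
    (by
      refine ContinuousOn.add (continuousOn_const.mul (ContinuousOn.inv₀ (by fun_prop) ?_))
        (continuousOn_const.mul (ContinuousOn.inv₀ (by fun_prop) ?_))
      · exact fun u hu => pow_ne_zero 2 (hpos u hu).ne'
      · exact fun u hu => pow_ne_zero 2 (hne u hu))
    (fun u hu h0 => by
      have := hφlow u hu
      rw [h0, abs_zero] at this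
      have : 0 < 2 * t * ε := by positivity
      linarith)
    (fun u hu => by
      have hu0 := hpos u hu
      set d := |u - c| with hd
      have hd0 : 0 < d := hε.trans_le (hdist u hu)
      set p := |φ' u| with hp
      have hp1 : 2 * t * d ≤ p := hlow u hu0
      have hp0 : 0 < p := lt_of_lt_of_le (by positivity) hp1
      have hsq : φ' u ^ 2 = p ^ 2 := (sq_abs _).symm
      have hsq' : (u - c) ^ 2 = d ^ 2 := (sq_abs _).symm
      have e1 : ‖a' u‖ / p ≤ K / u / p := by gcongr; exact haK u hu0
      have e2 : ‖a u‖ * |φ'' u| / p ^ 2 ≤ 1 * (4 * t + p / u) / p ^ 2 := by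
        gcongr
        · exact ha1 u hu0
        · exact hup u hu0
      have e3 : K / u / p + 1 * (4 * t + p / u) / p ^ 2 =
          (K + 1) * (u⁻¹ * p⁻¹) + 4 * t * (p⁻¹) ^ 2 := by
        field_simp; ring
      have e4 : p⁻¹ ≤ (2 * t)⁻¹ * d⁻¹ := by
        rw [← mul_inv]; exact inv_anti₀ (by positivity) hp1
      have e5 : (K + 1) * (u⁻¹ * p⁻¹) + 4 * t * (p⁻¹) ^ 2 ≤
          (K + 1) * (u⁻¹ * ((2 * t)⁻¹ * d⁻¹)) + 4 * t * ((2 * t)⁻¹ * d⁻¹) ^ 2 := by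
        gcongr
      have e6 : u⁻¹ * d⁻¹ ≤ (u⁻¹ ^ 2 + d⁻¹ ^ 2) / 2 := by nlinarith [sq_nonneg (u⁻¹ - d⁻¹)]
      have e7 : (K + 1) * (u⁻¹ * ((2 * t)⁻¹ * d⁻¹)) + 4 * t * ((2 * t)⁻¹ * d⁻¹) ^ 2 =
          (K + 1) / (2 * t) * (u⁻¹ * d⁻¹) + 1 / t * d⁻¹ ^ 2 := by
        field_simp; ring
      have e8 : (K + 1) / (2 * t) * (u⁻¹ * d⁻¹) + 1 / t * d⁻¹ ^ 2 ≤
          (K + 1) / (2 * t) * ((u⁻¹ ^ 2 + d⁻¹ ^ 2) / 2) + 1 / t * d⁻¹ ^ 2 := by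
        gcongr
      have e9 : (K + 1) / (2 * t) * ((u⁻¹ ^ 2 + d⁻¹ ^ 2) / 2) + 1 / t * d⁻¹ ^ 2 = h' u := by
        simp only [hh', hsq']
        field_simp; ring
      rw [hsq]
      linarith)
  have hbd : ∀ u ∈ Set.Icc A B, ‖a u‖ / |φ' u| ≤ 1 / (2 * t * ε) := fun u hu =>
    div_le_div₀ zero_le_one (ha1 u (hpos u hu)) (by positivity) (hφlow u hu)
  have hA' := hbd A ⟨le_rfl, hAB⟩
  have hB' := hbd B ⟨hAB, le_rfl⟩
  have i1 : A⁻¹ ≤ ε⁻¹ := inv_anti₀ hε hA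
  have i2 : 0 ≤ B⁻¹ := inv_nonneg.2 (by linarith)
  have i3 : (A - c)⁻¹ - (B - c)⁻¹ ≤ ε⁻¹ := by
    rcases hc with h | h
    · have := inv_anti₀ hε (show ε ≤ A - c by linarith)
      have : 0 ≤ (B - c)⁻¹ := inv_nonneg.2 (by linarith)
      linarith
    · have := inv_anti₀ hε (show ε ≤ c - B by linarith)
      have e : (B - c)⁻¹ = -(c - B)⁻¹ := by rw [← inv_neg, neg_sub]
      have : (A - c)⁻¹ ≤ 0 := inv_nonpos.2 (by linarith)
      linarith
  have j1 : (K + 1) / (4 * t) * (A⁻¹ - B⁻¹) ≤ (K + 1) / (4 * t) * ε⁻¹ := by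
    gcongr; linarith
  have j2 : (K + 5) / (4 * t) * ((A - c)⁻¹ - (B - c)⁻¹) ≤ (K + 5) / (4 * t) * ε⁻¹ := by
    gcongr
  have j3 : 1 / (2 * t * ε) + 1 / (2 * t * ε) + ((K + 1) / (4 * t) * ε⁻¹ +
      (K + 5) / (4 * t) * ε⁻¹) = (K + 5) / 2 / (t * ε) := by
    field_simp; ring
  have j4 : h B - h A = (K + 1) / (4 * t) * (A⁻¹ - B⁻¹) +
      (K + 5) / (4 * t) * ((A - c)⁻¹ - (B - c)⁻¹) := by
    simp only [hh]; ring
  linarith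

/-- Oscillatory integral over a half-line whose phase is at least as convex as `t u ^ 2` around its
stationary point `c`. -/
lemma norm_integral_Ioi_le {c t ε K : ℝ} (ht : 0 < t) (hε : 0 < ε) (htε : t * ε ^ 2 = 1)
    (hK : 0 ≤ K) (hc : 0 ≤ c)
    {a a' : ℝ → ℂ} {φ φ' φ'' : ℝ → ℝ}
    (ha : ∀ u, 0 < u → HasDerivAt a (a' u) u)
    (hφ : ∀ u, 0 < u → HasDerivAt φ (φ' u) u)
    (hφ' : ∀ u, 0 < u → HasDerivAt φ' (φ'' u) u)
    (ha'c : ContinuousOn a' (Set.Ioi 0)) (hφ''c : ContinuousOn φ'' (Set.Ioi 0))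
    (ha1 : ∀ u, 0 < u → ‖a u‖ ≤ 1) (haK : ∀ u, 0 < u → ‖a' u‖ ≤ K / u)
    (hlow : ∀ u, 0 < u → 2 * t * |u - c| ≤ |φ' u|)
    (hup : ∀ u, 0 < u → |φ'' u| ≤ 4 * t + |φ' u| / u) :
    ‖∫ u in Set.Ioi 0, a u * cexp (I * (φ u : ℂ))‖ ≤ (K + 8) * ε := by
  set g : ℝ → ℂ := fun u => a u * cexp (I * (φ u : ℂ)) with hg
  by_cases hint : IntegrableOn g (Set.Ioi 0)
  swap
  · rw [integral_undef hint, norm_zero]; positivity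
  have hlim := intervalIntegral_tendsto_integral_Ioi 0 hint Filter.tendsto_id
  refine le_of_tendsto hlim.norm ?_
  filter_upwards [Filter.eventually_ge_atTop (c + ε)] with R hR
  have hg1 : ∀ u, 0 < u → ‖g u‖ ≤ 1 := fun u hu => by
    rw [hg, norm_mul, mul_comm I, Complex.norm_exp_ofReal_mul_I, mul_one]
    exact ha1 u hu
  set m := max ε (c - ε) with hm
  have hm1 : ε ≤ m := le_max_left _ _
  have hm2 : m ≤ c + ε := max_le (by linarith) (by linarith)
  have hm3 : c - ε ≤ m := le_max_right _ _
  have hii : ∀ p q, 0 ≤ p → 0 ≤ q → IntervalIntegrable g volume p q := by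
    intro p q hp hq
    rw [intervalIntegrable_iff]
    exact hint.mono_set fun u hu => lt_of_le_of_lt (le_min hp hq) hu.1
  have hshort : ∀ p q, 0 ≤ p → p ≤ q → ‖∫ u in p..q, g u‖ ≤ q - p := by
    intro p q hp hpq
    have := intervalIntegral.norm_integral_le_of_norm_le_const (a := p) (b := q) (f := g) (C := 1)
      fun u hu => hg1 u (by rw [Set.uIoc_of_le hpq] at hu; exact lt_of_le_of_lt hp hu.1)
    rwa [one_mul, abs_of_nonneg (by linarith)] at this
  have htε' : (K + 5) / 2 / (t * ε) = (K + 5) / 2 * ε := by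
    rw [div_eq_iff (by positivity)]
    linear_combination (-(K + 5) / 2) * htε
  have h1 := hshort 0 ε le_rfl hε.le
  have h2 : ‖∫ u in ε..m, g u‖ ≤ (K + 5) / 2 * ε := by
    rcases le_total (c - ε) ε with h | h
    · rw [hm, max_eq_left h, intervalIntegral.integral_same, norm_zero]; positivity
    · rw [← htε']
      exact norm_integral_away_le hm1 ht hε hK le_rfl (Or.inr (by rw [hm, max_eq_right h]))
        ha hφ hφ' ha'c hφ''c ha1 haK hlow hup
  have h3 := hshort m (c + ε) (by linarith) hm2
  have h4 : ‖∫ u in (c + ε)..R, g u‖ ≤ (K + 5) / 2 * ε := by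
    rw [← htε']
    exact norm_integral_away_le hR ht hε hK (by linarith) (Or.inl le_rfl)
      ha hφ hφ' ha'c hφ''c ha1 haK hlow hup
  have hsplit : ∫ u in (0 : ℝ)..R, g u = (∫ u in (0 : ℝ)..ε, g u) + (∫ u in ε..m, g u) +
      (∫ u in m..(c + ε), g u) + ∫ u in (c + ε)..R, g u := by
    rw [intervalIntegral.integral_add_adjacent_intervals,
      intervalIntegral.integral_add_adjacent_intervals,
      intervalIntegral.integral_add_adjacent_intervals] <;> apply hii <;> linarith
  rw [id, hsplit]
  have n1 := norm_add_le ((∫ u in (0 : ℝ)..ε, g u) + (∫ u in ε..m, g u) +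
      (∫ u in m..(c + ε), g u)) (∫ u in (c + ε)..R, g u)
  have n2 := norm_add_le ((∫ u in (0 : ℝ)..ε, g u) + (∫ u in ε..m, g u))
      (∫ u in m..(c + ε), g u)
  have n3 := norm_add_le (∫ u in (0 : ℝ)..ε, g u) (∫ u in ε..m, g u)
  linarith

/-- The derivative of the phase `X u ^ γ + t u ^ 2` is bounded below by that of `t (u - c) ^ 2`, for
a suitable `c`. -/
lemma exists_le_abs_deriv_phase {t γ : ℝ} (X : ℝ) (ht : 0 < t) (hγ0 : 0 < γ) (hγ1 : γ < 1) :
    ∃ c, 0 ≤ c ∧ ∀ u, 0 < u → 2 * t * |u - c| ≤ |X * (γ * u ^ (γ - 1)) + 2 * t * u| := by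
  rcases le_or_gt 0 X with hX | hX
  · refine ⟨0, le_rfl, fun u hu => ?_⟩
    rw [sub_zero, abs_of_pos hu]
    refine le_trans ?_ (le_abs_self _)
    have : 0 ≤ X * (γ * u ^ (γ - 1)) := by positivity
    linarith
  · set b := -X * γ / (2 * t) with hb
    have hb0 : 0 < b := div_pos (mul_pos (by linarith) hγ0) (by positivity)
    set c := b ^ (1 / (2 - γ)) with hcdef
    have hc0 : 0 < c := rpow_pos_of_pos hb0 _
    have hbc : b = c * c ^ (1 - γ) := by
      nth_rewrite 1 [← rpow_one c]
      rw [← rpow_add hc0, hcdef, ← rpow_mul hb0.le, show 1 / (2 - γ) * (1 + (1 - γ)) = 1 by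
        have : 2 - γ ≠ 0 := by linarith
        field_simp; ring, rpow_one]
    refine ⟨c, hc0.le, fun u hu => ?_⟩
    have hu' : u ^ (γ - 1) = (u ^ (1 - γ))⁻¹ := by rw [← rpow_neg hu.le, neg_sub]
    have hup : 0 < u ^ (1 - γ) := rpow_pos_of_pos hu _
    have e : X * (γ * u ^ (γ - 1)) + 2 * t * u =
        2 * t * (u - c * (c ^ (1 - γ) / u ^ (1 - γ))) := by
      have hX' : X * γ = -(2 * t) * (c * c ^ (1 - γ)) := by
        rw [← hbc, hb]; field_simp
      rw [hu', ← mul_assoc, hX']; field_simp; ring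
    rw [e, abs_mul, abs_of_pos (by positivity : 0 < 2 * t)]
    refine mul_le_mul_of_nonneg_left ?_ (by positivity)
    rcases le_total c u with h | h
    · have hq : c ^ (1 - γ) / u ^ (1 - γ) ≤ 1 :=
        (div_le_one hup).2 (rpow_le_rpow hc0.le h (by linarith))
      have := mul_le_of_le_one_right hc0.le hq
      rw [abs_of_nonneg (by linarith)]
      exact le_trans (by linarith) (le_abs_self _)
    · have hq : 1 ≤ c ^ (1 - γ) / u ^ (1 - γ) :=
        (one_le_div hup).2 (rpow_le_rpow hu.le h (by linarith))
      have := le_mul_of_one_le_right hc0.le hq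
      rw [abs_of_nonpos (by linarith)]
      exact le_trans (by linarith) (neg_le_abs _)

lemma norm_integral_quadratic_le {γ δ t : ℝ} (μ X : ℝ) (hγ0 : 0 < γ) (hγ1 : γ < 1) (hδ : 0 < δ)
    (ht : 0 < t) :
    ‖∫ u in Set.Ioi (0 : ℝ), cexp (((-(δ * u ^ (2 * γ)) : ℝ) : ℂ) + I * ((μ * Real.log u : ℝ) : ℂ)) *
      cexp (I * ((X * u ^ γ + t * u ^ 2 : ℝ) : ℂ))‖ ≤ (|μ| + 10) * t ^ (-(1 / 2) : ℝ) := by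
  obtain ⟨c, hc, hlow⟩ := exists_le_abs_deriv_phase X ht hγ0 hγ1
  have hε : 0 < t ^ (-(1 / 2) : ℝ) := rpow_pos_of_pos ht _
  have htε : t * (t ^ (-(1 / 2) : ℝ)) ^ 2 = 1 := by
    rw [← rpow_natCast, ← rpow_mul ht.le]
    norm_num [rpow_neg_one, ht.ne']
  set a : ℝ → ℂ := fun u =>
    cexp (((-(δ * u ^ (2 * γ)) : ℝ) : ℂ) + I * ((μ * Real.log u : ℝ) : ℂ)) with ha
  set a' : ℝ → ℂ := fun u => a u *
    (((-(δ * (2 * γ * u ^ (2 * γ - 1))) : ℝ) : ℂ) + I * ((μ * u⁻¹ : ℝ) : ℂ)) with ha'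
  have had : ∀ u, 0 < u → HasDerivAt a (a' u) u := fun u hu =>
    ((((Real.hasDerivAt_rpow_const (Or.inl hu.ne')).const_mul δ).neg.ofReal_comp).add
      (((Real.hasDerivAt_log hu.ne').const_mul μ).ofReal_comp.const_mul I)).cexp
  have han : ∀ u, ‖a u‖ = rexp (-(δ * u ^ (2 * γ))) := fun u => by
    rw [ha, Complex.norm_exp]
    congr 1
    simp only [Complex.add_re, Complex.ofReal_re, Complex.I_mul_re, Complex.ofReal_im, neg_zero,
      add_zero]
  have hrpc : ∀ s : ℝ, ContinuousOn (fun u : ℝ => u ^ s) (Set.Ioi 0) := fun s u hu =>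
    (Real.continuousAt_rpow_const u s (Or.inl (ne_of_gt hu))).continuousWithinAt
  have hac : ContinuousOn a (Set.Ioi 0) := fun u hu => (had u hu).continuousAt.continuousWithinAt
  have hinvc : ContinuousOn (fun u : ℝ => u⁻¹) (Set.Ioi 0) :=
    continuousOn_inv₀.mono fun u hu => ne_of_gt hu
  have h1 := hrpc (2 * γ - 1)
  have h2 := hrpc (γ - 1 - 1)
  have main := norm_integral_Ioi_le (c := c) (K := |μ| + 2) ht hε htε (by positivity) hc
    (a := a) (a' := a') (φ := fun u => X * u ^ γ + t * u ^ 2)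
    (φ' := fun u => X * (γ * u ^ (γ - 1)) + 2 * t * u)
    (φ'' := fun u => X * (γ * ((γ - 1) * u ^ (γ - 1 - 1))) + 2 * t) had
    (fun u hu => by
      refine (((Real.hasDerivAt_rpow_const (Or.inl hu.ne')).const_mul X).add
        ((hasDerivAt_pow 2 u).const_mul t)).congr_deriv ?_
      push_cast; ring)
    (fun u hu => by
      refine ((((Real.hasDerivAt_rpow_const (Or.inl hu.ne')).const_mul γ).const_mul X).add
        ((hasDerivAt_id u).const_mul (2 * t))).congr_deriv ?_
      ring)
    (by
      refine hac.mul ?_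
      fun_prop)
    (by fun_prop)
    (fun u hu => by
      rw [han]
      refine Real.exp_le_one_iff.2 (neg_nonpos.2 ?_)
      positivity)
    (fun u hu => by
      set s := δ * u ^ (2 * γ) with hs
      have hs0 : 0 ≤ s := by positivity
      have e1 : δ * (2 * γ * u ^ (2 * γ - 1)) = 2 * γ * s / u := by
        rw [rpow_sub_one hu.ne', hs]; ring
      have e2 : rexp (-s) * s ≤ 1 := by
        rw [Real.exp_neg, inv_mul_le_iff₀ (Real.exp_pos s)]
        linarith [Real.add_one_le_exp s]
      have e3 : rexp (-s) ≤ 1 := Real.exp_le_one_iff.2 (neg_nonpos.2 hs0)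
      rw [ha', norm_mul, han]
      calc _ ≤ rexp (-s) * (2 * γ * s / u + |μ| / u) := by
            refine mul_le_mul_of_nonneg_left ((norm_add_le _ _).trans (le_of_eq ?_))
              (Real.exp_pos _).le
            rw [norm_mul, Complex.norm_I, one_mul, Complex.norm_real, Complex.norm_real,
              Real.norm_eq_abs, Real.norm_eq_abs, abs_neg, e1, abs_of_nonneg (by positivity),
              abs_mul, abs_of_pos (inv_pos.2 hu), div_eq_mul_inv |μ|]
        _ = (rexp (-s) * |μ| + 2 * γ * (rexp (-s) * s)) / u := by ring
        _ ≤ (1 * |μ| + 2 * 1 * 1) / u := by gcongr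
        _ = _ := by ring)
    hlow
    (fun u hu => by
      set p := X * (γ * u ^ (γ - 1)) + 2 * t * u with hp
      have e : X * (γ * ((γ - 1) * u ^ (γ - 1 - 1))) + 2 * t =
          (2 - γ) * (2 * t) + (γ - 1) * (p / u) := by
        rw [rpow_sub_one hu.ne' (γ - 1), hp]
        field_simp; ring
      have e0 : 0 ≤ |p| / u := by positivity
      rw [e]
      refine (abs_add_le _ _).trans ?_
      rw [abs_mul, abs_mul (γ - 1), abs_of_pos (by linarith : 0 < 2 - γ),
        abs_of_pos (by linarith : 0 < 2 * t), abs_of_neg (by linarith : γ - 1 < 0), abs_div,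
        abs_of_pos hu]
      nlinarith)
  refine main.trans (le_of_eq ?_)
  ring

lemma norm_integral_Ioi_dispersive_le_of_pos {α δ t : ℝ} (κ X : ℝ) (hα : 1 < α) (hδ : 0 < δ)
    (ht : 0 < t) :
    ‖∫ ξ in Set.Ioi (0 : ℝ), ((ξ ^ ((α - 1) / 2) : ℝ) : ℂ) *
      (cexp (((-(δ * ξ ^ 2) : ℝ) : ℂ) + I * ((κ * Real.log ξ : ℝ) : ℂ)) *
      cexp (I * ((X * ξ + t * ξ ^ (α + 1) : ℝ) : ℂ)))‖ ≤ (|κ| + 10) * t ^ (-(1 / 2) : ℝ) := by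
  set p := (α + 1) / 2 with hp
  have hp1 : 1 < p := by rw [hp]; linarith
  have hp0 : 0 < p := by linarith
  have hq1 : p⁻¹ < 1 := inv_lt_one_of_one_lt₀ hp1
  have hq0 : 0 < p⁻¹ := inv_pos.2 hp0
  have main := norm_integral_quadratic_le (κ * p⁻¹) X hq0 hq1 hδ ht
  rw [← integral_comp_rpow_Ioi _ hp0.ne'] at main
  have e : ∫ ξ in Set.Ioi (0 : ℝ), ((ξ ^ ((α - 1) / 2) : ℝ) : ℂ) *
      (cexp (((-(δ * ξ ^ 2) : ℝ) : ℂ) + I * ((κ * Real.log ξ : ℝ) : ℂ)) *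
      cexp (I * ((X * ξ + t * ξ ^ (α + 1) : ℝ) : ℂ))) =
      p⁻¹ • ∫ ξ in Set.Ioi (0 : ℝ), (|p| * ξ ^ (p - 1)) •
        (cexp (((-(δ * (ξ ^ p) ^ (2 * p⁻¹)) : ℝ) : ℂ) +
          I * ((κ * p⁻¹ * Real.log (ξ ^ p) : ℝ) : ℂ)) *
        cexp (I * ((X * (ξ ^ p) ^ p⁻¹ + t * (ξ ^ p) ^ 2 : ℝ) : ℂ))) := by
    rw [← integral_smul]
    refine setIntegral_congr_fun measurableSet_Ioi fun ξ hξ => ?_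
    have hξ0 : 0 < ξ := hξ
    have i1 : (ξ ^ p) ^ (2 * p⁻¹) = ξ ^ 2 := by
      rw [← rpow_mul hξ0.le, show p * (2 * p⁻¹) = (2 : ℕ) by push_cast; field_simp, rpow_natCast]
    have i2 : (ξ ^ p) ^ p⁻¹ = ξ := rpow_rpow_inv hξ0.le hp0.ne'
    have i3 : (ξ ^ p) ^ 2 = ξ ^ (α + 1) := by
      rw [← rpow_natCast, ← rpow_mul hξ0.le]
      congr 1; rw [hp]; push_cast; ring
    have i4 : κ * p⁻¹ * Real.log (ξ ^ p) = κ * Real.log ξ := by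
      rw [Real.log_rpow hξ0]; field_simp
    have i5 : p - 1 = (α - 1) / 2 := by rw [hp]; ring
    rw [i1, i2, i3, i4, i5, smul_smul, abs_of_pos hp0, inv_mul_cancel_left₀ hp0.ne',
      Complex.real_smul]
  rw [e, norm_smul, Real.norm_of_nonneg hq0.le]
  refine (mul_le_of_le_one_left (norm_nonneg _) hq1.le).trans (main.trans ?_)
  have hκ : |κ * p⁻¹| ≤ |κ| := by
    rw [abs_mul, abs_of_pos hq0]
    exact mul_le_of_le_one_right (abs_nonneg _) hq1.le
  exact mul_le_mul_of_nonneg_right (by linarith) (rpow_pos_of_pos ht _).le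

lemma norm_integral_Ioi_dispersive_le {α δ t : ℝ} (κ X : ℝ) (hα : 1 < α) (hδ : 0 < δ)
    (ht : t ≠ 0) :
    ‖∫ ξ in Set.Ioi (0 : ℝ), ((ξ ^ ((α - 1) / 2) : ℝ) : ℂ) *
      (cexp (((-(δ * ξ ^ 2) : ℝ) : ℂ) + I * ((κ * Real.log ξ : ℝ) : ℂ)) *
      cexp (I * ((X * ξ + t * ξ ^ (α + 1) : ℝ) : ℂ)))‖ ≤ (|κ| + 10) * |t| ^ (-(1 / 2) : ℝ) := by
  rcases lt_or_gt_of_ne ht with h | h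
  · have main := norm_integral_Ioi_dispersive_le_of_pos (-κ) (-X) hα hδ (neg_pos.2 h)
    rw [abs_of_neg h, ← RCLike.norm_conj, ← integral_conj]
    rw [abs_neg] at main
    refine (congrArg norm (integral_congr_ae (Filter.Eventually.of_forall fun ξ => ?_))).trans_le
      main
    simp only [map_mul, ← Complex.exp_conj, map_add, Complex.conj_ofReal, Complex.conj_I]
    congr 3 <;> push_cast <;> ring
  · rw [abs_of_pos h]
    exact norm_integral_Ioi_dispersive_le_of_pos κ X hα hδ h

/-- Oscillatory integral estimate: for `4/3 < α ≤ 6` there is `C > 0` depending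
only on `α` such that for all `κ ∈ ℝ`, `δ > 0`, `t ≠ 0` and `x, y ∈ ℝ`,
`|∫ |ξ|^{(α-1)/2} e^{iκ log|ξ|} e^{-δξ²}
   e^{i(xξ + tξ|ξ|^α + sgn(ξ/t)π/4 + ξy²/(4t))} dξ| ≤ C⟨κ⟩|t|^{-1/2}`. -/
theorem oscillatory_integral_estimate (α : ℝ) (hα1 : 4 / 3 < α) (hα2 : α ≤ 6) :
    ∃ C > 0, ∀ κ δ t x y : ℝ, 0 < δ → t ≠ 0 →
      ‖∫ ξ : ℝ, ((|ξ| ^ ((α - 1) / 2) : ℝ) : ℂ) *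
          Complex.exp (Complex.I * ((κ * Real.log |ξ| : ℝ) : ℂ)) *
          Complex.exp (((-(δ * ξ ^ 2) : ℝ) : ℂ)) *
          Complex.exp (Complex.I *
            ((x * ξ + t * ξ * |ξ| ^ α + Real.sign (ξ / t) * (Real.pi / 4)
              + ξ * y ^ 2 / (4 * t) : ℝ) : ℂ))‖
        ≤ C * Real.sqrt (1 + κ ^ 2) * |t| ^ (-(1 / 2) : ℝ) := by
  refine ⟨22, by norm_num, fun κ δ t x y hδ ht => ?_⟩
  have hα : 1 < α := by linarith
  set f : ℝ → ℂ := fun ξ => ((|ξ| ^ ((α - 1) / 2) : ℝ) : ℂ) *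
          Complex.exp (Complex.I * ((κ * Real.log |ξ| : ℝ) : ℂ)) *
          Complex.exp (((-(δ * ξ ^ 2) : ℝ) : ℂ)) *
          Complex.exp (Complex.I *
            ((x * ξ + t * ξ * |ξ| ^ α + Real.sign (ξ / t) * (Real.pi / 4)
              + ξ * y ^ 2 / (4 * t) : ℝ) : ℂ)) with hf
  have hs : 0 < |t| ^ (-(1 / 2) : ℝ) := rpow_pos_of_pos (abs_pos.2 ht) _
  by_cases hint : Integrable f
  swap
  · rw [integral_undef hint, norm_zero]; positivity
  set X := x + y ^ 2 / (4 * t) with hX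
  have hsign : ∀ ξ, 0 < ξ → Real.sign (ξ / t) = Real.sign t := fun ξ hξ => by
    rcases lt_or_gt_of_ne ht with h | h
    · rw [Real.sign_of_neg h, Real.sign_of_neg (div_neg_of_pos_of_neg hξ h)]
    · rw [Real.sign_of_pos h, Real.sign_of_pos (div_pos hξ h)]
  have hpos : ∀ ξ, 0 < ξ → f ξ = cexp (((Real.sign t * (Real.pi / 4) : ℝ) : ℂ) * I) *
      (((ξ ^ ((α - 1) / 2) : ℝ) : ℂ) *
      (cexp (((-(δ * ξ ^ 2) : ℝ) : ℂ) + I * ((κ * Real.log ξ : ℝ) : ℂ)) *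
      cexp (I * ((X * ξ + t * ξ ^ (α + 1) : ℝ) : ℂ)))) := by
    intro ξ hξ
    have e : x * ξ + t * ξ * ξ ^ α + Real.sign t * (Real.pi / 4) + ξ * y ^ 2 / (4 * t) =
        Real.sign t * (Real.pi / 4) + (X * ξ + t * ξ ^ (α + 1)) := by
      rw [rpow_add_one hξ.ne', hX]; ring
    simp only [hf]
    rw [abs_of_pos hξ, hsign ξ hξ, e, Complex.ofReal_add, mul_add, Complex.exp_add,
      Complex.exp_add, mul_comm I ((Real.sign t * (Real.pi / 4) : ℝ) : ℂ)]
    ring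
  have hneg : ∀ ξ, 0 < ξ → f (-ξ) = cexp (((-(Real.sign t * (Real.pi / 4)) : ℝ) : ℂ) * I) *
      (((ξ ^ ((α - 1) / 2) : ℝ) : ℂ) *
      (cexp (((-(δ * ξ ^ 2) : ℝ) : ℂ) + I * ((κ * Real.log ξ : ℝ) : ℂ)) *
      cexp (I * ((-X * ξ + -t * ξ ^ (α + 1) : ℝ) : ℂ)))) := by
    intro ξ hξ
    have e : x * -ξ + t * -ξ * ξ ^ α + -Real.sign t * (Real.pi / 4) + -ξ * y ^ 2 / (4 * t) =
        -(Real.sign t * (Real.pi / 4)) + (-X * ξ + -t * ξ ^ (α + 1)) := by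
      rw [rpow_add_one hξ.ne', hX]; ring
    simp only [hf]
    rw [abs_neg, abs_of_pos hξ, neg_div, Real.sign_neg, hsign ξ hξ, e, Complex.ofReal_add,
      mul_add, Complex.exp_add, Complex.exp_add, neg_sq,
      mul_comm I ((-(Real.sign t * (Real.pi / 4)) : ℝ) : ℂ)]
    ring
  have hsplit : ∫ ξ, f ξ = (∫ ξ in Set.Ioi 0, f (-ξ)) + ∫ ξ in Set.Ioi 0, f ξ := by
    rw [integral_comp_neg_Ioi, neg_zero,
      intervalIntegral.integral_Iic_add_Ioi hint.integrableOn hint.integrableOn]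
  have b1 : ‖∫ ξ in Set.Ioi 0, f ξ‖ ≤ (|κ| + 10) * |t| ^ (-(1 / 2) : ℝ) := by
    rw [setIntegral_congr_fun measurableSet_Ioi fun ξ hξ => hpos ξ hξ, integral_const_mul, norm_mul,
      Complex.norm_exp_ofReal_mul_I, one_mul]
    exact norm_integral_Ioi_dispersive_le κ X hα hδ ht
  have b2 : ‖∫ ξ in Set.Ioi 0, f (-ξ)‖ ≤ (|κ| + 10) * |t| ^ (-(1 / 2) : ℝ) := by
    rw [setIntegral_congr_fun measurableSet_Ioi fun ξ hξ => hneg ξ hξ, integral_const_mul, norm_mul,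
      Complex.norm_exp_ofReal_mul_I, one_mul, ← abs_neg t]
    exact norm_integral_Ioi_dispersive_le κ (-X) hα hδ (neg_ne_zero.2 ht)
  have k1 : |κ| ≤ Real.sqrt (1 + κ ^ 2) := Real.abs_le_sqrt (by linarith)
  have k2 : 1 ≤ Real.sqrt (1 + κ ^ 2) := Real.one_le_sqrt.2 (by nlinarith [sq_nonneg κ])
  rw [hsplit]
  calc _ ≤ 2 * (|κ| + 10) * |t| ^ (-(1 / 2) : ℝ) := by
        linarith [norm_add_le (∫ ξ in Set.Ioi 0, f (-ξ)) (∫ ξ in Set.Ioi 0, f ξ)]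
    _ ≤ _ := by
        refine mul_le_mul_of_nonneg_right ?_ hs.le
        linarith
end

section
/- Let 4/3<α≤6, θ:=1−α/2 and κ∈ℝ. There exists a constant C>0 depending only on α such that for every Schwartz function u₀∈𝒮(ℝ²), every t∈ℝ with t≠0 and every (x,y)∈ℝ², the absolutely convergent integral v(x,y) := ∫_{ℝ²} e^{i(xξ+yη)} |ξ|^{−θ} e^{iκ·log|ξ|} e^{it(ξ|ξ|^α − η²/ξ)} û₀(ξ,η) dξ dη satisfies |v(x,y)| ≤ C·⟨κ⟩·|t|^{−1}·‖u₀‖_{L¹(ℝ²)}. -/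
open Real MeasureTheory Complex

lemma norm_integral_cexp_phase_le {A B : ℝ} (hAB : A ≤ B) {Φ Φ' Φ'' : ℝ → ℝ}
    (h1 : ∀ x ∈ Set.Icc A B, HasDerivAt Φ (Φ' x) x)
    (h2 : ∀ x ∈ Set.Icc A B, HasDerivAt Φ' (Φ'' x) x)
    (hc : ContinuousOn Φ'' (Set.Icc A B)) :
    ‖∫ x in A..B, cexp (I * (Φ x : ℂ))‖ ≤
      1 + ∫ x in A..B, (1 + |Φ'' x|) / (1 + Φ' x ^ 2) := by
  have hpos : ∀ x, (1 + Φ' x ^ 2) ≠ 0 := fun x => by positivity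
  have cΦ : ContinuousOn Φ (Set.Icc A B) := fun x hx => (h1 x hx).continuousAt.continuousWithinAt
  have cΦ' : ContinuousOn Φ' (Set.Icc A B) := fun x hx => (h2 x hx).continuousAt.continuousWithinAt
  have cE : ContinuousOn (fun x => cexp (I * (Φ x : ℂ))) (Set.Icc A B) := by fun_prop
  set r : ℝ → ℂ := fun x => ((1 / (1 + Φ' x ^ 2) : ℝ) : ℂ) +
    I * (((1 - Φ' x ^ 2) / (1 + Φ' x ^ 2) ^ 2 * Φ'' x : ℝ) : ℂ) with hr
  have cr : ContinuousOn r (Set.Icc A B) := by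
    have c1 : ContinuousOn (fun x => 1 / (1 + Φ' x ^ 2)) (Set.Icc A B) :=
      ContinuousOn.div (by fun_prop) (by fun_prop) fun x _ => hpos x
    have c2 : ContinuousOn (fun x => (1 - Φ' x ^ 2) / (1 + Φ' x ^ 2) ^ 2 * Φ'' x)
        (Set.Icc A B) :=
      (ContinuousOn.div (by fun_prop) (by fun_prop) fun x _ => pow_ne_zero 2 (hpos x)).mul hc
    fun_prop
  set G : ℝ → ℂ := fun x => cexp (I * (Φ x : ℂ)) * (-I * ((Φ' x / (1 + Φ' x ^ 2) : ℝ) : ℂ))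
    with hG
  have hGd : ∀ x ∈ Set.Icc A B,
      HasDerivAt G (cexp (I * (Φ x : ℂ)) - cexp (I * (Φ x : ℂ)) * r x) x := by
    intro x hx
    have e1 := (((h1 x hx).ofReal_comp).const_mul I).cexp
    have e2 := (((h2 x hx).div (((h2 x hx).pow 2).const_add 1) (hpos x)).ofReal_comp).const_mul (-I)
    refine (e1.mul e2).congr_deriv ?_
    have hp : (1 + (Φ' x : ℂ) ^ 2) ≠ 0 := by exact_mod_cast hpos x
    simp only [hr, Pi.pow_apply, Pi.div_apply]
    push_cast
    field_simp
    ring_nf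
    simp only [I_sq]
    ring
  have uI : Set.uIcc A B = Set.Icc A B := Set.uIcc_of_le hAB
  have iE : IntervalIntegrable (fun x => cexp (I * (Φ x : ℂ))) volume A B :=
    ContinuousOn.intervalIntegrable (by rwa [uI])
  have iEr : IntervalIntegrable (fun x => cexp (I * (Φ x : ℂ)) * r x) volume A B :=
    ContinuousOn.intervalIntegrable (by rw [uI]; exact cE.mul cr)
  have key := intervalIntegral.integral_eq_sub_of_hasDerivAt (fun x hx => hGd x (uI ▸ hx))
    (iE.sub iEr)
  rw [intervalIntegral.integral_sub iE iEr] at key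
  have hnE : ∀ x, ‖cexp (I * (Φ x : ℂ))‖ = 1 := fun x => by
    rw [mul_comm]; exact norm_exp_ofReal_mul_I _
  have hGn : ∀ x, ‖G x‖ ≤ 1 / 2 := by
    intro x
    simp only [hG]
    rw [norm_mul, hnE, norm_mul, norm_neg, norm_I, Complex.norm_real, Real.norm_eq_abs,
      one_mul, one_mul, abs_div, abs_of_pos (by positivity : 0 < 1 + Φ' x ^ 2),
      div_le_iff₀ (by positivity)]
    nlinarith [sq_nonneg (|Φ' x| - 1), sq_abs (Φ' x)]
  have hrn : ∀ x, ‖r x‖ ≤ (1 + |Φ'' x|) / (1 + Φ' x ^ 2) := by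
    intro x
    simp only [hr]
    refine (norm_add_le _ _).trans ?_
    rw [norm_mul, norm_I, Complex.norm_real, Complex.norm_real, one_mul, add_div,
      Real.norm_eq_abs, Real.norm_eq_abs, abs_of_pos (by positivity : 0 < 1 / (1 + Φ' x ^ 2)),
      abs_mul, abs_div, abs_of_pos (by positivity : 0 < (1 + Φ' x ^ 2) ^ 2)]
    gcongr
    rw [div_mul_eq_mul_div, div_le_div_iff₀ (by positivity) (by positivity)]
    have : |1 - Φ' x ^ 2| ≤ 1 + Φ' x ^ 2 := abs_le.2 ⟨by nlinarith, by nlinarith [sq_nonneg (Φ' x)]⟩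
    calc _ = |1 - Φ' x ^ 2| * (|Φ'' x| * (1 + Φ' x ^ 2)) := by ring
      _ ≤ (1 + Φ' x ^ 2) * (|Φ'' x| * (1 + Φ' x ^ 2)) := by gcongr
      _ = _ := by ring
  have : ∫ x in A..B, cexp (I * (Φ x : ℂ)) =
      (G B - G A) + ∫ x in A..B, cexp (I * (Φ x : ℂ)) * r x := by rw [← key]; ring
  rw [this]
  refine (norm_add_le _ _).trans (add_le_add ?_ ?_)
  · refine (norm_sub_le _ _).trans ?_
    linarith [hGn A, hGn B]
  · refine intervalIntegral.norm_integral_le_of_norm_le hAB (ae_of_all _ fun x _ => ?_) ?_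
    · rw [norm_mul, hnE, one_mul]; exact hrn x
    · refine ContinuousOn.intervalIntegrable ?_
      rw [uI]
      exact ContinuousOn.div (by fun_prop) (by fun_prop) fun x _ => hpos x

lemma norm_integral_cexp_of_le_left {β : ℝ} (h0 : 0 < β) (hβ : β < 1) (ν κ : ℝ) {A B : ℝ}
    (hA : √(1 + κ ^ 2) ≤ A) (hAB : A ≤ B) :
    ‖∫ s in A..B, cexp (I * ((s ^ 2 + ν * s ^ β + κ * Real.log s : ℝ) : ℂ))‖ ≤ 9 := by
  have hM : 1 ≤ √(1 + κ ^ 2) := Real.one_le_sqrt.2 (by nlinarith)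
  have hpos : ∀ s ∈ Set.Icc A B, 0 < s := fun s hs => by linarith [hs.1]
  have hκ : ∀ s ∈ Set.Icc A B, |κ| ≤ s ^ 2 := by
    intro s hs
    have h3 : 1 + κ ^ 2 ≤ s ^ 2 := by
      rw [← Real.sq_sqrt (by positivity : 0 ≤ 1 + κ ^ 2)]
      exact pow_le_pow_left₀ (by positivity) (hA.trans hs.1) 2
    nlinarith [sq_nonneg (|κ| - 1), sq_abs κ]
  set Φ' : ℝ → ℝ := fun s => 2 * s + ν * (β * s ^ (β - 1)) + κ * s⁻¹ with hΦ'
  set Φ'' : ℝ → ℝ := fun s => 2 + ν * (β * ((β - 1) * s ^ (β - 2))) - κ * (s ^ 2)⁻¹ with hΦ''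
  have d1 : ∀ s ∈ Set.Icc A B,
      HasDerivAt (fun s => s ^ 2 + ν * s ^ β + κ * Real.log s) (Φ' s) s := by
    intro s hs
    have hs0 := (hpos s hs).ne'
    refine (((hasDerivAt_pow 2 s).add ((Real.hasDerivAt_rpow_const (.inl hs0)).const_mul ν)).add
      ((Real.hasDerivAt_log hs0).const_mul κ)).congr_deriv ?_
    simp [hΦ']
  have d2 : ∀ s ∈ Set.Icc A B, HasDerivAt Φ' (Φ'' s) s := by
    intro s hs
    have hs0 := (hpos s hs).ne'
    refine ((((hasDerivAt_id s).const_mul 2).add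
      (((Real.hasDerivAt_rpow_const (p := β - 1) (.inl hs0)).const_mul β).const_mul ν)).add
      ((hasDerivAt_inv hs0).const_mul κ)).congr_deriv ?_
    simp only [hΦ'']
    rw [show β - 1 - 1 = β - 2 by ring]
    ring
  have c2 : ContinuousOn Φ'' (Set.Icc A B) := by
    have e1 : ContinuousOn (fun s : ℝ => s ^ (β - 2)) (Set.Icc A B) := fun s hs =>
      (Real.continuousAt_rpow_const _ _ (.inl (hpos s hs).ne')).continuousWithinAt
    have e2 : ContinuousOn (fun s : ℝ => (s ^ 2)⁻¹) (Set.Icc A B) :=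
      ContinuousOn.inv₀ (by fun_prop) fun s hs => (pow_pos (hpos s hs) 2).ne'
    fun_prop
  have c1 : ContinuousOn Φ' (Set.Icc A B) := fun x hx => (d2 x hx).continuousAt.continuousWithinAt
  refine (norm_integral_cexp_phase_le hAB d1 d2 c2).trans ?_
  have uI : Set.uIcc A B = Set.Icc A B := Set.uIcc_of_le hAB
  have iL : IntervalIntegrable (fun x => (1 + |Φ'' x|) / (1 + Φ' x ^ 2)) volume A B := by
    refine ContinuousOn.intervalIntegrable ?_
    rw [uI]
    exact ContinuousOn.div (by fun_prop) (by fun_prop) fun x _ => by positivity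
  have hκs : ∀ s ∈ Set.Icc A B, |κ * (s ^ 2)⁻¹| ≤ 1 := by
    intro s hs
    have := hpos s hs
    rw [abs_mul, abs_of_pos (by positivity : 0 < (s ^ 2)⁻¹), ← div_eq_mul_inv,
      div_le_one (by positivity)]
    exact hκ s hs
  rcases le_total ν 0 with hν | hν
  · have hΦ1 : ∀ s ∈ Set.Icc A B, 1 ≤ Φ'' s := by
      intro s hs
      have h4 := (abs_le.1 (hκs s hs)).2
      have h5 : 0 ≤ ν * (β * ((β - 1) * s ^ (β - 2))) := by
        have : 0 < s ^ (β - 2) := Real.rpow_pos_of_pos (hpos s hs) _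
        have : (β - 1) * s ^ (β - 2) ≤ 0 := by nlinarith
        exact mul_nonneg_of_nonpos_of_nonpos hν (mul_nonpos_of_nonneg_of_nonpos h0.le this)
      simp only [hΦ'']
      linarith
    have iR : IntervalIntegrable (fun x => 2 * (1 / (1 + Φ' x ^ 2) * Φ'' x)) volume A B := by
      refine ContinuousOn.intervalIntegrable ?_
      rw [uI]
      have : ContinuousOn (fun x => 1 / (1 + Φ' x ^ 2)) (Set.Icc A B) :=
        ContinuousOn.div (by fun_prop) (by fun_prop) fun x _ => by positivity
      fun_prop
    have h6 : ∫ x in A..B, (1 + |Φ'' x|) / (1 + Φ' x ^ 2) ≤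
        ∫ x in A..B, 2 * (1 / (1 + Φ' x ^ 2) * Φ'' x) := by
      refine intervalIntegral.integral_mono_on hAB iL iR fun x hx => ?_
      have := hΦ1 x hx
      rw [abs_of_pos (by linarith), ← sub_nonneg]
      have : 2 * (1 / (1 + Φ' x ^ 2) * Φ'' x) - (1 + Φ'' x) / (1 + Φ' x ^ 2) =
        (Φ'' x - 1) / (1 + Φ' x ^ 2) := by field_simp; ring
      rw [this]
      exact div_nonneg (by linarith) (by positivity)
    have h7 := intervalIntegral.integral_eq_sub_of_hasDerivAt
      (fun x hx => ((d2 x (uI ▸ hx)).arctan.const_mul 2)) iR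
    rw [h7] at h6
    have := Real.arctan_lt_pi_div_two (Φ' B)
    have := Real.neg_pi_div_two_lt_arctan (Φ' A)
    linarith [Real.pi_lt_d2]
  · have hb : ∀ s ∈ Set.Icc A B, (1 + |Φ'' s|) / (1 + Φ' s ^ 2) ≤ 4 * (s ^ 2)⁻¹ := by
      intro s hs
      have hs0 := hpos s hs
      have hs1 : 1 ≤ s := by linarith [hs.1]
      obtain ⟨w, hw⟩ : ∃ w, w = ν * (β * s ^ (β - 1)) := ⟨_, rfl⟩
      have hw0 : 0 ≤ w := by rw [hw]; positivity
      have hw2 : ν * (β * ((β - 1) * s ^ (β - 2))) = (β - 1) * (w / s) := by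
        rw [hw, show β - 2 = β - 1 - 1 by ring, Real.rpow_sub_one hs0.ne']
        ring
      have hk := hκ s hs
      have hk2 : |κ * s⁻¹| ≤ s := by
        rw [abs_mul, abs_of_pos (by positivity : 0 < s⁻¹), ← div_eq_mul_inv, div_le_iff₀ hs0]
        linarith
      have hv : s + w ≤ Φ' s := by
        simp only [hΦ', ← hw]
        linarith [(abs_le.1 hk2).1]
      have ha : |Φ'' s| ≤ 3 + w / s := by
        simp only [hΦ'', hw2]
        have h8 := abs_le.1 (hκs s hs)
        have h9 : 0 ≤ w / s := by positivity
        rw [abs_le]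
        constructor <;> nlinarith
      have ha2 : |Φ'' s| * s ≤ 3 * Φ' s := by
        calc |Φ'' s| * s ≤ (3 + w / s) * s := by gcongr
          _ = 3 * s + w := by field_simp
          _ ≤ _ := by linarith
      rw [div_le_iff₀ (by positivity), mul_assoc, mul_comm, ← sub_nonneg]
      have hvs : s ≤ Φ' s := by linarith
      have : (s ^ 2)⁻¹ * (1 + Φ' s ^ 2) * 4 - (1 + |Φ'' s|) =
        (4 + 4 * Φ' s ^ 2 - s ^ 2 - |Φ'' s| * s * s) / s ^ 2 := by field_simp; ring
      rw [this]
      refine div_nonneg ?_ (by positivity)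
      have : |Φ'' s| * s * s ≤ 3 * Φ' s * Φ' s := by
        have := abs_nonneg (Φ'' s)
        gcongr
        linarith
      nlinarith
    have d3 : ∀ s ∈ Set.uIcc A B, HasDerivAt (fun s : ℝ => (-4) * s⁻¹) (4 * (s ^ 2)⁻¹) s := by
      intro s hs
      refine ((hasDerivAt_inv (hpos s (uI ▸ hs)).ne').const_mul (-4)).congr_deriv ?_
      ring
    have iR : IntervalIntegrable (fun s : ℝ => 4 * (s ^ 2)⁻¹) volume A B := by
      refine ContinuousOn.intervalIntegrable ?_
      rw [uI]
      have e2 : ContinuousOn (fun s : ℝ => (s ^ 2)⁻¹) (Set.Icc A B) :=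
        ContinuousOn.inv₀ (by fun_prop) fun s hs => (pow_pos (hpos s hs) 2).ne'
      fun_prop
    have h6 := intervalIntegral.integral_mono_on hAB iL iR hb
    rw [intervalIntegral.integral_eq_sub_of_hasDerivAt d3 iR] at h6
    have : A⁻¹ ≤ 1 := inv_le_one_of_one_le₀ (by linarith)
    have : 0 ≤ B⁻¹ := inv_nonneg.2 (by linarith)
    linarith

lemma norm_integral_cexp_le {β : ℝ} (h0 : 0 < β) (hβ : β < 1) (ν κ : ℝ) {A B : ℝ}
    (hA : 0 < A) (hAB : A ≤ B) :
    ‖∫ s in A..B, cexp (I * ((s ^ 2 + ν * s ^ β + κ * Real.log s : ℝ) : ℂ))‖ ≤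
      10 * √(1 + κ ^ 2) := by
  set M := √(1 + κ ^ 2) with hMdef
  have hM : 1 ≤ M := Real.one_le_sqrt.2 (by nlinarith)
  have hn : ∀ s : ℝ, ‖cexp (I * ((s ^ 2 + ν * s ^ β + κ * Real.log s : ℝ) : ℂ))‖ ≤ 1 := fun s => by
    rw [mul_comm]; exact (norm_exp_ofReal_mul_I _).le
  have triv : ∀ C, A ≤ C → C ≤ M →
      ‖∫ s in A..C, cexp (I * ((s ^ 2 + ν * s ^ β + κ * Real.log s : ℝ) : ℂ))‖ ≤ M := by
    intro C h1 h2
    refine (intervalIntegral.norm_integral_le_of_norm_le_const fun s _ => hn s).trans ?_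
    rw [abs_of_nonneg (by linarith)]; linarith
  rcases le_total B M with hB | hB
  · linarith [triv B hAB hB]
  rcases le_total M A with hM2 | hM2
  · linarith [norm_integral_cexp_of_le_left h0 hβ ν κ hM2 hAB]
  have hI : ∀ C D, 0 < C → C ≤ D → IntervalIntegrable
      (fun s : ℝ => cexp (I * ((s ^ 2 + ν * s ^ β + κ * Real.log s : ℝ) : ℂ))) volume C D := by
    intro C D hC hCD
    refine ContinuousOn.intervalIntegrable ?_
    rw [Set.uIcc_of_le hCD]
    have hp : ∀ s ∈ Set.Icc C D, s ≠ 0 := fun s hs => (hC.trans_le hs.1).ne'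
    have e1 : ContinuousOn (fun s : ℝ => s ^ β) (Set.Icc C D) := by fun_prop (disch := grind)
    have e2 : ContinuousOn (fun s : ℝ => Real.log s) (Set.Icc C D) := Real.continuousOn_log.mono hp
    fun_prop
  rw [← intervalIntegral.integral_add_adjacent_intervals (hI A M hA hM2) (hI M B (by linarith) hB)]
  refine (norm_add_le _ _).trans ?_
  linarith [triv M hM2 le_rfl, norm_integral_cexp_of_le_left h0 hβ ν κ le_rfl hB]

lemma norm_integral_mul_exp_neg_le {f : ℝ → ℂ} (hf : ContinuousOn f (Set.Ioi 0)) {a b c K : ℝ}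
    (ha : 0 < a) (hab : a ≤ b) (hc : 0 ≤ c)
    (hK : ∀ x ∈ Set.Icc a b, ‖∫ y in a..x, f y‖ ≤ K) :
    ‖∫ x in a..b, f x * ((Real.exp (-(c * x)) : ℝ) : ℂ)‖ ≤ K := by
  have uI : Set.uIcc a b = Set.Icc a b := Set.uIcc_of_le hab
  have hi : ∀ x, 0 < x → IntervalIntegrable f volume a x := fun x hx =>
    (hf.mono fun y hy => lt_of_lt_of_le (lt_min ha hx) hy.1).intervalIntegrable
  have hJ : ∀ x ∈ Set.uIcc a b, HasDerivAt (fun x => ∫ y in a..x, f y) (f x) x := by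
    intro x hx
    have hx0 : 0 < x := ha.trans_le (uI ▸ hx).1
    exact intervalIntegral.integral_hasDerivAt_right (hi x hx0)
      (hf.stronglyMeasurableAtFilter isOpen_Ioi x hx0) (hf.continuousAt (Ioi_mem_nhds hx0))
  have hE : ∀ x ∈ Set.uIcc a b, HasDerivAt (fun x => ((Real.exp (-(c * x)) : ℝ) : ℂ))
      ((Real.exp (-(c * x)) * (-c) : ℝ) : ℂ) x := by
    intro x _
    refine HasDerivAt.ofReal_comp ((((hasDerivAt_id x).const_mul c).neg).exp.congr_deriv ?_)
    simp
  have key := intervalIntegral.integral_deriv_mul_eq_sub hJ hE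
    (hi b (ha.trans_le hab)) (Continuous.intervalIntegrable (by fun_prop) _ _)
  have cJ : ContinuousOn (fun x => ∫ y in a..x, f y) (Set.uIcc a b) := fun x hx =>
    (hJ x hx).continuousAt.continuousWithinAt
  have i1 : IntervalIntegrable (fun x => f x * ((Real.exp (-(c * x)) : ℝ) : ℂ)) volume a b :=
    (hi b (ha.trans_le hab)).mul_continuousOn (by fun_prop)
  have i2 : IntervalIntegrable
      (fun x => (∫ y in a..x, f y) * ((Real.exp (-(c * x)) * (-c) : ℝ) : ℂ)) volume a b :=
    ContinuousOn.intervalIntegrable (cJ.mul (by fun_prop))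
  rw [intervalIntegral.integral_add i1 i2, intervalIntegral.integral_same, zero_mul, sub_zero,
    ← eq_sub_iff_add_eq] at key
  rw [key]
  have hdK : ∫ x in a..b, K * (Real.exp (-(c * x)) * c) =
      K * (Real.exp (-(c * a)) - Real.exp (-(c * b))) := by
    have : ∀ x ∈ Set.uIcc a b, HasDerivAt (fun x => -K * Real.exp (-(c * x)))
        (K * (Real.exp (-(c * x)) * c)) x := by
      intro x _
      refine ((((hasDerivAt_id x).const_mul c).neg).exp.const_mul (-K)).congr_deriv ?_
      simp
    rw [intervalIntegral.integral_eq_sub_of_hasDerivAt this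
      (Continuous.intervalIntegrable (by fun_prop) _ _)]
    ring
  have hK0 : 0 ≤ K := (norm_nonneg _).trans (hK a ⟨le_rfl, hab⟩)
  have b1 : ‖(∫ y in a..b, f y) * ((Real.exp (-(c * b)) : ℝ) : ℂ)‖ ≤ K * Real.exp (-(c * b)) := by
    rw [norm_mul, Complex.norm_real, Real.norm_eq_abs, Real.abs_exp]
    have := hK b ⟨hab, le_rfl⟩
    gcongr
  have b2 : ‖∫ x in a..b, (∫ y in a..x, f y) * ((Real.exp (-(c * x)) * (-c) : ℝ) : ℂ)‖ ≤
      ∫ x in a..b, K * (Real.exp (-(c * x)) * c) := by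
    refine intervalIntegral.norm_integral_le_of_norm_le hab (ae_of_all _ fun x hx => ?_)
      (Continuous.intervalIntegrable (by fun_prop) _ _)
    rw [norm_mul, Complex.norm_real, Real.norm_eq_abs, abs_mul, Real.abs_exp, abs_neg,
      abs_of_nonneg hc]
    have := hK x ⟨hx.1.le, hx.2⟩
    gcongr
  rw [hdK] at b2
  refine (norm_sub_le _ _).trans ((add_le_add b1 b2).trans ?_)
  have : Real.exp (-(c * a)) ≤ 1 := Real.exp_le_one_iff.2 (by nlinarith)
  nlinarith

lemma norm_integral_cexp_mul_rpow_le_of_pos {α : ℝ} (hα : 1 < α) (μ κ : ℝ) {t a b : ℝ} (ht : 0 < t)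
    (ha : 0 < a) (hab : a ≤ b) :
    ‖∫ ξ in a..b, cexp (I * ((μ * ξ + κ * Real.log ξ + t * (ξ * ξ ^ α) : ℝ) : ℂ)) *
      ((ξ ^ ((α - 1) / 2) : ℝ) : ℂ)‖ ≤ 10 * √(1 + κ ^ 2) / √t := by
  obtain ⟨m, hm⟩ : ∃ m, m = α + 1 := ⟨_, rfl⟩
  have hm2 : 2 < m := by linarith
  have hm0 : m ≠ 0 := by linarith
  have hst : 0 < √t := Real.sqrt_pos.2 ht
  set f : ℝ → ℝ := fun ξ => √t * ξ ^ (m / 2) with hf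
  set f' : ℝ → ℝ := fun ξ => √t * (m / 2 * ξ ^ (m / 2 - 1)) with hf'
  set ν := μ / √t ^ (2 / m) with hν
  set g : ℝ → ℂ := fun s =>
    cexp (I * ((s ^ 2 + ν * s ^ (2 / m) + (2 * κ / m) * Real.log s : ℝ) : ℂ)) with hg
  have uI : Set.uIcc a b = Set.Icc a b := Set.uIcc_of_le hab
  have hpos : ∀ ξ ∈ Set.uIcc a b, 0 < ξ := fun ξ hξ => ha.trans_le (uI ▸ hξ).1
  have hfd : ∀ ξ ∈ Set.uIcc a b, HasDerivAt f (f' ξ) ξ := fun ξ hξ =>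
    (Real.hasDerivAt_rpow_const (.inl (hpos ξ hξ).ne')).const_mul _
  have hf'c : ContinuousOn f' (Set.uIcc a b) := by
    have : ContinuousOn (fun ξ : ℝ => ξ ^ (m / 2 - 1)) (Set.uIcc a b) := fun ξ hξ =>
      (Real.continuousAt_rpow_const _ _ (.inl (hpos ξ hξ).ne')).continuousWithinAt
    fun_prop
  have hgc : ContinuousOn g (f '' Set.uIcc a b) := by
    have hp : ∀ s ∈ f '' Set.uIcc a b, s ≠ 0 := by
      rintro _ ⟨ξ, hξ, rfl⟩
      exact (mul_pos hst (Real.rpow_pos_of_pos (hpos ξ hξ) _)).ne'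
    have e1 : ContinuousOn (fun s : ℝ => s ^ (2 / m)) (f '' Set.uIcc a b) := fun s hs =>
      (Real.continuousAt_rpow_const _ _ (.inl (hp s hs))).continuousWithinAt
    have e2 : ContinuousOn (fun s : ℝ => Real.log s) (f '' Set.uIcc a b) :=
      Real.continuousOn_log.mono hp
    fun_prop
  have hsub := intervalIntegral.integral_deriv_smul_comp' hfd hf'c hgc
  have heq : ∫ ξ in a..b, cexp (I * ((μ * ξ + κ * Real.log ξ + t * (ξ * ξ ^ α) : ℝ) : ℂ)) *
      ((ξ ^ ((α - 1) / 2) : ℝ) : ℂ) =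
      (((2 / (m * √t) : ℝ) : ℂ) * cexp (((-(2 * κ / m * Real.log √t) : ℝ) : ℂ) * I)) *
        ∫ ξ in a..b, f' ξ • (g ∘ f) ξ := by
    rw [← intervalIntegral.integral_const_mul]
    refine intervalIntegral.integral_congr fun ξ hξ => ?_
    have h0 := hpos ξ hξ
    have hr := Real.rpow_pos_of_pos h0 (m / 2)
    have q1 : f ξ ^ 2 = t * (ξ * ξ ^ α) := by
      simp only [hf]
      rw [mul_pow, Real.sq_sqrt ht.le, ← Real.rpow_mul_natCast h0.le, ← Real.rpow_one_add' h0.le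
        (by linarith)]
      congr 2
      push_cast; linarith
    have q2 : ν * f ξ ^ (2 / m) = μ * ξ := by
      simp only [hf, hν]
      rw [Real.mul_rpow hst.le hr.le, ← Real.rpow_mul h0.le,
        show m / 2 * (2 / m) = 1 by field_simp, Real.rpow_one]
      have := (Real.rpow_pos_of_pos hst (2 / m)).ne'
      field_simp
    have q3 : (2 * κ / m) * Real.log (f ξ) = 2 * κ / m * Real.log √t + κ * Real.log ξ := by
      simp only [hf]
      rw [Real.log_mul hst.ne' hr.ne', Real.log_rpow h0]
      field_simp
    have q4 : f' ξ = (m * √t / 2) * ξ ^ ((α - 1) / 2) := by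
      simp only [hf']
      rw [show m / 2 - 1 = (α - 1) / 2 by linarith]
      ring
    simp only [Function.comp, hg, q1, q2, q3, q4, Complex.real_smul]
    have e3 : cexp (I * ((μ * ξ + κ * Real.log ξ + t * (ξ * ξ ^ α) : ℝ) : ℂ)) =
      cexp (((-(2 * κ / m * Real.log √t) : ℝ) : ℂ) * I) * cexp (I * ((t * (ξ * ξ ^ α) + μ * ξ +
        (2 * κ / m * Real.log √t + κ * Real.log ξ) : ℝ) : ℂ)) := by
      rw [← Complex.exp_add]
      congr 1
      push_cast; ring
    rw [e3]
    have e4 : ((2 / (m * √t) : ℝ) : ℂ) * ((m * √t / 2 : ℝ) : ℂ) = 1 := by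
      rw [← Complex.ofReal_mul, show 2 / (m * √t) * (m * √t / 2) = 1 by field_simp,
        Complex.ofReal_one]
    rw [Complex.ofReal_mul (m * √t / 2)]
    linear_combination (-1 : ℂ) * (cexp (((-(2 * κ / m * Real.log √t) : ℝ) : ℂ) * I) *
      cexp (I * ((t * (ξ * ξ ^ α) + μ * ξ +
        (2 * κ / m * Real.log √t + κ * Real.log ξ) : ℝ) : ℂ)) * ((ξ ^ ((α - 1) / 2) : ℝ) : ℂ)) * e4
  have hfa : 0 < f a := mul_pos hst (Real.rpow_pos_of_pos ha _)
  have hfab : f a ≤ f b := by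
    simp only [hf]
    gcongr
  have hκ : (2 * κ / m) ^ 2 ≤ κ ^ 2 := by
    rw [sq_le_sq, abs_div, abs_mul, abs_of_pos (by linarith : 0 < m), abs_two,
      div_le_iff₀ (by linarith)]
    nlinarith [abs_nonneg κ]
  have hb := norm_integral_cexp_le (β := 2 / m) (by positivity)
    ((div_lt_one (by linarith)).2 hm2) ν (2 * κ / m) hfa hfab
  rw [heq, hsub, norm_mul, norm_mul, norm_exp_ofReal_mul_I, Complex.norm_real, Real.norm_eq_abs,
    abs_of_pos (by positivity), mul_one]
  have h2 : 2 / (m * √t) ≤ 1 / √t := by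
    rw [div_le_div_iff₀ (by positivity) hst]; nlinarith
  calc _ ≤ 1 / √t * (10 * √(1 + κ ^ 2)) := by
        gcongr
        exact hb.trans (by gcongr)
    _ = _ := by ring

lemma norm_integral_cexp_mul_rpow_le {α : ℝ} (hα : 1 < α) (μ κ : ℝ) {t a b : ℝ} (ht : t ≠ 0)
    (ha : 0 < a) (hab : a ≤ b) :
    ‖∫ ξ in a..b, cexp (I * ((μ * ξ + κ * Real.log ξ + t * (ξ * ξ ^ α) : ℝ) : ℂ)) *
      ((ξ ^ ((α - 1) / 2) : ℝ) : ℂ)‖ ≤ 10 * √(1 + κ ^ 2) / √|t| := by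
  rcases ht.lt_or_gt with h | h
  · have := norm_integral_cexp_mul_rpow_le_of_pos hα (-μ) (-κ) (neg_pos.2 h) ha hab
    rw [neg_sq, ← abs_of_neg h] at this
    rw [intervalIntegral.integral_of_le hab] at this ⊢
    rw [← RCLike.norm_conj, ← integral_conj]
    refine le_of_eq_of_le (congrArg norm (integral_congr_ae (ae_of_all _ fun ξ => ?_))) this
    simp only [map_mul, ← Complex.exp_conj, Complex.conj_I, Complex.conj_ofReal]
    rw [abs_of_neg h]
    congr 2
    push_cast; ring
  · rw [abs_of_pos h]
    exact norm_integral_cexp_mul_rpow_le_of_pos hα μ κ h ha hab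

lemma norm_integral_cexp_mul_rpow_mul_exp_neg_le {α : ℝ} (hα : 1 < α) (μ κ : ℝ) {t a b c : ℝ}
    (ht : t ≠ 0) (ha : 0 < a) (hab : a ≤ b) (hc : 0 ≤ c) :
    ‖∫ ξ in a..b, cexp (I * ((μ * ξ + κ * Real.log ξ + t * (ξ * ξ ^ α) : ℝ) : ℂ)) *
      ((ξ ^ ((α - 1) / 2) : ℝ) : ℂ) * ((Real.exp (-(c * ξ)) : ℝ) : ℂ)‖ ≤
        10 * √(1 + κ ^ 2) / √|t| := by
  refine norm_integral_mul_exp_neg_le ?_ ha hab hc fun x hx =>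
    norm_integral_cexp_mul_rpow_le hα μ κ ht ha hx.1
  have hr : ∀ p : ℝ, ContinuousOn (fun ξ : ℝ => ξ ^ p) (Set.Ioi 0) := fun p ξ hξ =>
    (Real.continuousAt_rpow_const _ _ (.inl (ne_of_gt hξ))).continuousWithinAt
  have e1 := hr α
  have e2 := hr ((α - 1) / 2)
  have e3 : ContinuousOn (fun s : ℝ => Real.log s) (Set.Ioi 0) :=
    Real.continuousOn_log.mono fun s hs => ne_of_gt hs
  fun_prop

/-- The Fourier multiplier `|ξ|^{-θ} e^{iκ log|ξ|} e^{it(ξ|ξ|^α - η²/ξ)}`, truncated to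
`a < |ξ| ≤ b` and damped by `e^{-δη²/|ξ|}`. -/
noncomputable def dampedSymbol (α κ t δ a b : ℝ) : ℝ × ℝ → ℂ :=
  {q : ℝ × ℝ | |q.1| ∈ Set.Ioc a b}.indicator fun q =>
    ((|q.1| ^ (-(1 - α / 2)) : ℝ) : ℂ) *
      Complex.exp (Complex.I * ((κ * Real.log |q.1| : ℝ) : ℂ)) *
      Complex.exp (Complex.I * ((t * (q.1 * |q.1| ^ α - q.2 ^ 2 / q.1) : ℝ) : ℂ)) *
      ((Real.exp (-(δ * q.2 ^ 2 / |q.1|)) : ℝ) : ℂ)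

lemma norm_cexp_I_mul_ofReal (r : ℝ) : ‖cexp (I * (r : ℂ))‖ = 1 := by
  rw [mul_comm, norm_exp_ofReal_mul_I]

lemma measurableSet_abs_fst_mem_Ioc (a b : ℝ) :
    MeasurableSet {q : ℝ × ℝ | |q.1| ∈ Set.Ioc a b} :=
  measurableSet_Ioc.preimage (by fun_prop : Measurable fun q : ℝ × ℝ => |q.1|)

lemma integrable_dampedSymbol (α κ t : ℝ) {δ a b : ℝ} (hδ : 0 < δ) (ha : 0 < a) (hab : a ≤ b) :
    Integrable (dampedSymbol α κ t δ a b) := by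
  have hb : 0 < b := ha.trans_le hab
  have hK : IsCompact {x : ℝ | |x| ∈ Set.Icc a b} := by
    refine Metric.isCompact_of_isClosed_isBounded (isClosed_Icc.preimage continuous_abs) ?_
    refine (Metric.isBounded_Icc (-b) b).subset fun x hx => ?_
    exact abs_le.1 hx.2
  have h1 : Integrable ({x : ℝ | |x| ∈ Set.Icc a b}.indicator
      fun x => |x| ^ (-(1 - α / 2))) := by
    rw [integrable_indicator_iff hK.measurableSet]
    refine ContinuousOn.integrableOn_compact hK fun x hx => ?_
    exact ((Real.continuousAt_rpow_const _ _ (.inl (ha.trans_le hx.1).ne')).comp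
      continuous_abs.continuousAt).continuousWithinAt
  have h2 : Integrable fun y : ℝ => Real.exp (-(δ / b) * y ^ 2) :=
    integrable_exp_neg_mul_sq (by positivity)
  refine (h1.mul_prod h2).mono' ?_ (ae_of_all _ fun q => ?_)
  · refine (Measurable.indicator ?_ (measurableSet_abs_fst_mem_Ioc a b)).aestronglyMeasurable
    fun_prop
  · by_cases hq : |q.1| ∈ Set.Ioc a b
    · have hq' : q.1 ∈ {x : ℝ | |x| ∈ Set.Icc a b} := ⟨hq.1.le, hq.2⟩
      rw [dampedSymbol, Set.indicator_of_mem (by exact hq), Set.indicator_of_mem hq', norm_mul, norm_mul,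
        norm_mul, norm_cexp_I_mul_ofReal, norm_cexp_I_mul_ofReal, mul_one, mul_one,
        Complex.norm_real, Complex.norm_real, Real.norm_eq_abs, Real.norm_eq_abs, Real.abs_exp,
        abs_of_nonneg (by positivity)]
      have hq0 : 0 < |q.1| := ha.trans hq.1
      gcongr
      rw [neg_mul, neg_le_neg_iff, div_mul_eq_mul_div]
      have := hq.2
      gcongr
    · rw [dampedSymbol, Set.indicator_of_notMem (by exact hq), norm_zero]
      refine mul_nonneg (Set.indicator_nonneg (fun _ _ => by positivity) _) (Real.exp_nonneg _)

lemma integral_cexp_mul_gaussian (Y t : ℝ) {δ ξ : ℝ} (hδ : 0 < δ) (hξ : 0 < ξ) :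
    ∫ η : ℝ, cexp (I * ((Y * η : ℝ) : ℂ)) * cexp (-(((δ : ℂ) + t * I) / ξ) * (η : ℂ) ^ 2) =
      ((ξ ^ (1 / 2 : ℝ) : ℝ) : ℂ) * ((π / (δ + t * I)) ^ (1 / 2 : ℂ)) *
        cexp (I * ((Y ^ 2 * t / (4 * (δ ^ 2 + t ^ 2)) * ξ : ℝ) : ℂ)) *
        ((Real.exp (-(Y ^ 2 * δ / (4 * (δ ^ 2 + t ^ 2)) * ξ)) : ℝ) : ℂ) := by
  have hre : 0 < (((δ : ℂ) + t * I) / ξ).re := by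
    rw [Complex.div_ofReal_re]
    simpa using div_pos hδ hξ
  have hz : (δ : ℂ) + t * I ≠ 0 := by
    intro h
    have := congrArg Complex.re h
    simp at this
    exact hδ.ne' this
  have hξ' : (ξ : ℂ) ≠ 0 := by exact_mod_cast hξ.ne'
  have key := fourierIntegral_gaussian hre (Y : ℂ)
  simp only [Complex.ofReal_mul, ← mul_assoc]
  rw [key]
  have e1 : (π : ℂ) / (((δ : ℂ) + t * I) / ξ) = (ξ : ℂ) * (π / (δ + t * I)) := by
    field_simp
  have e2 : ((ξ : ℂ) * (π / (δ + t * I))) ^ (1 / 2 : ℂ) =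
      ((ξ ^ (1 / 2 : ℝ) : ℝ) : ℂ) * (π / (δ + t * I)) ^ (1 / 2 : ℂ) := by
    have hπ : (π : ℂ) / (δ + t * I) ≠ 0 := div_ne_zero (by exact_mod_cast pi_ne_zero) hz
    rw [Complex.ofReal_cpow hξ.le, Complex.cpow_def_of_ne_zero (mul_ne_zero hξ' hπ),
      Complex.cpow_def_of_ne_zero hξ', Complex.cpow_def_of_ne_zero hπ, ← Complex.exp_add,
      Complex.log_ofReal_mul hξ hπ, Complex.ofReal_log hξ.le]
    congr 1
    push_cast
    ring
  rw [e1, e2]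
  have hd : (δ : ℂ) ^ 2 + (t : ℂ) ^ 2 ≠ 0 := by
    exact_mod_cast (by positivity : δ ^ 2 + t ^ 2 ≠ 0)
  rw [mul_assoc _ (cexp _), Complex.ofReal_exp, ← Complex.exp_add]
  push_cast
  congr 2
  have : ((δ : ℂ) + t * I) * (δ - t * I) = δ ^ 2 + t ^ 2 := by
    ring_nf; rw [I_sq]; ring
  rw [← this]
  have hz2 : (δ : ℂ) - t * I ≠ 0 := by
    intro h
    rw [h, mul_zero] at this
    exact hd this.symm
  field_simp
  ring

lemma norm_integral_Ioi_dampedSymbol_le {α : ℝ} (hα : 1 < α) (κ X Y : ℝ) {t δ a b : ℝ}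
    (ht : t ≠ 0) (hδ : 0 < δ) (ha : 0 < a) (hab : a ≤ b) :
    ‖∫ ξ in Set.Ioi (0 : ℝ), ∫ η : ℝ, cexp (I * ((X * ξ + Y * η : ℝ) : ℂ)) *
      dampedSymbol α κ t δ a b (ξ, η)‖ ≤ 10 * √π * √(1 + κ ^ 2) * |t|⁻¹ := by
  set c := Y ^ 2 * δ / (4 * (δ ^ 2 + t ^ 2)) with hc
  set μ := X + Y ^ 2 * t / (4 * (δ ^ 2 + t ^ 2)) with hμ
  set Z : ℂ := (π / (δ + t * I)) ^ (1 / 2 : ℂ) with hZ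
  set f : ℝ → ℂ := fun ξ => cexp (I * ((μ * ξ + κ * Real.log ξ + t * (ξ * ξ ^ α) : ℝ) : ℂ)) *
      ((ξ ^ ((α - 1) / 2) : ℝ) : ℂ) * ((Real.exp (-(c * ξ)) : ℝ) : ℂ) with hf
  have h1 : ∀ ξ ∈ Set.Ioi (0 : ℝ), ∫ η : ℝ, cexp (I * ((X * ξ + Y * η : ℝ) : ℂ)) *
      dampedSymbol α κ t δ a b (ξ, η) = (Set.Ioc a b).indicator (fun ξ => Z * f ξ) ξ := by
    intro ξ hξ
    have hξ0 : 0 < ξ := hξ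
    by_cases h : ξ ∈ Set.Ioc a b
    · rw [Set.indicator_of_mem h]
      have e1 : ∀ η : ℝ, cexp (I * ((X * ξ + Y * η : ℝ) : ℂ)) * dampedSymbol α κ t δ a b (ξ, η) =
          (cexp (I * ((X * ξ + κ * Real.log ξ + t * (ξ * ξ ^ α) : ℝ) : ℂ)) *
            ((ξ ^ (-(1 - α / 2)) : ℝ) : ℂ)) * (cexp (I * ((Y * η : ℝ) : ℂ)) *
              cexp (-(((δ : ℂ) + t * I) / ξ) * (η : ℂ) ^ 2)) := by
        intro η
        rw [dampedSymbol, Set.indicator_of_mem (by simpa [abs_of_pos hξ0] using h)]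
        simp only [abs_of_pos hξ0]
        have hξ' : (ξ : ℂ) ≠ 0 := by exact_mod_cast hξ0.ne'
        have e2 : cexp (I * ((X * ξ + Y * η : ℝ) : ℂ)) *
            (cexp (I * ((κ * Real.log ξ : ℝ) : ℂ)) *
            cexp (I * ((t * (ξ * ξ ^ α - η ^ 2 / ξ) : ℝ) : ℂ)) *
            ((Real.exp (-(δ * η ^ 2 / ξ)) : ℝ) : ℂ)) =
            cexp (I * ((X * ξ + κ * Real.log ξ + t * (ξ * ξ ^ α) : ℝ) : ℂ)) *
            (cexp (I * ((Y * η : ℝ) : ℂ)) *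
              cexp (-(((δ : ℂ) + t * I) / ξ) * (η : ℂ) ^ 2)) := by
          rw [Complex.ofReal_exp]
          simp only [← Complex.exp_add]
          congr 1
          push_cast
          field_simp
          ring
        linear_combination ((ξ ^ (-(1 - α / 2)) : ℝ) : ℂ) * e2
      simp only [e1]
      rw [integral_const_mul, integral_cexp_mul_gaussian Y t hδ hξ0]
      have e3 : ((ξ ^ (-(1 - α / 2)) : ℝ) : ℂ) * ((ξ ^ (1 / 2 : ℝ) : ℝ) : ℂ) =
          ((ξ ^ ((α - 1) / 2) : ℝ) : ℂ) := by
        rw [← Complex.ofReal_mul, ← Real.rpow_add hξ0]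
        congr 2
        ring
      have e4 : cexp (I * ((X * ξ + κ * Real.log ξ + t * (ξ * ξ ^ α) : ℝ) : ℂ)) *
          cexp (I * ((Y ^ 2 * t / (4 * (δ ^ 2 + t ^ 2)) * ξ : ℝ) : ℂ)) =
          cexp (I * ((μ * ξ + κ * Real.log ξ + t * (ξ * ξ ^ α) : ℝ) : ℂ)) := by
        rw [← Complex.exp_add, hμ]
        congr 1
        push_cast
        ring
      simp only [hf]
      rw [← e3, ← e4]
      ring
    · rw [Set.indicator_of_notMem h]
      have : ∀ η : ℝ, dampedSymbol α κ t δ a b (ξ, η) = 0 := fun η => by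
        rw [dampedSymbol, Set.indicator_of_notMem (by simpa [abs_of_pos hξ0] using h)]
      simp [this]
  rw [setIntegral_congr_fun measurableSet_Ioi h1, setIntegral_indicator measurableSet_Ioc,
    Set.inter_eq_right.2 (show Set.Ioc a b ⊆ Set.Ioi 0 from fun x hx => ha.trans hx.1),
    integral_const_mul, norm_mul,
    ← intervalIntegral.integral_of_le hab]
  have hb := norm_integral_cexp_mul_rpow_mul_exp_neg_le hα μ κ (c := c) ht ha hab (by positivity)
  have hst : 0 < √|t| := Real.sqrt_pos.2 (abs_pos.2 ht)
  have hZn : ‖Z‖ ≤ √π / √|t| := by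
    have h2 : ‖Z‖ = ‖(π : ℂ) / (δ + t * I)‖ ^ (1 / 2 : ℝ) := by
      rw [hZ, show (1 / 2 : ℂ) = ((1 / 2 : ℝ) : ℂ) by push_cast; rfl, Complex.norm_cpow_real]
    rw [h2, ← Real.sqrt_eq_rpow, ← Real.sqrt_div pi_pos.le, norm_div, Complex.norm_real,
      Real.norm_eq_abs, abs_of_pos pi_pos]
    have h3 : |t| ≤ ‖(δ : ℂ) + t * I‖ := by
      simpa using Complex.abs_im_le_norm ((δ : ℂ) + t * I)
    have := abs_pos.2 ht
    gcongr
  calc ‖Z‖ * ‖∫ ξ in a..b, f ξ‖ ≤ (√π / √|t|) * (10 * √(1 + κ ^ 2) / √|t|) := by gcongr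
    _ = 10 * √π * √(1 + κ ^ 2) / (√|t| * √|t|) := by ring
    _ = _ := by rw [Real.mul_self_sqrt (abs_nonneg t)]; ring

lemma dampedSymbol_neg_fst (α κ t δ a b ξ η : ℝ) :
    dampedSymbol α κ t δ a b (-ξ, η) = dampedSymbol α κ (-t) δ a b (ξ, η) := by
  simp only [dampedSymbol, Set.indicator, Set.mem_ofPred_eq, abs_neg]
  congr 6
  ring_nf

lemma norm_integral_dampedSymbol_le {α : ℝ} (hα : 1 < α) (κ X Y : ℝ) {t δ a b : ℝ}
    (ht : t ≠ 0) (hδ : 0 < δ) (ha : 0 < a) (hab : a ≤ b) :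
    ‖∫ q : ℝ × ℝ, cexp (I * ((X * q.1 + Y * q.2 : ℝ) : ℂ)) * dampedSymbol α κ t δ a b q‖ ≤
      20 * √π * √(1 + κ ^ 2) * |t|⁻¹ := by
  have hint : Integrable fun q : ℝ × ℝ =>
      cexp (I * ((X * q.1 + Y * q.2 : ℝ) : ℂ)) * dampedSymbol α κ t δ a b q :=
    (integrable_dampedSymbol α κ t hδ ha hab).bdd_mul (c := 1)
      (Continuous.aestronglyMeasurable (by fun_prop))
      (ae_of_all _ fun q => (norm_cexp_I_mul_ofReal _).le)
  rw [Measure.volume_eq_prod] at hint ⊢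
  rw [integral_prod _ hint, ← intervalIntegral.integral_Iic_add_Ioi
    hint.integral_prod_left.integrableOn hint.integral_prod_left.integrableOn (b := 0)]
  have h1 := norm_integral_Ioi_dampedSymbol_le hα κ X Y ht hδ ha hab
  have h2 := norm_integral_Ioi_dampedSymbol_le hα κ (-X) Y (neg_ne_zero.2 ht) hδ ha hab
  simp only [← dampedSymbol_neg_fst, abs_neg] at h2
  have h3 := integral_comp_neg_Ioi 0 fun ξ : ℝ => ∫ η : ℝ,
    cexp (I * ((X * ξ + Y * η : ℝ) : ℂ)) * dampedSymbol α κ t δ a b (ξ, η)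
  simp only [mul_neg, neg_zero] at h3
  simp only [neg_mul, h3] at h2
  refine (norm_add_le _ _).trans ?_
  linarith

lemma norm_integral_mul_fourier_le {w u : ℝ × ℝ → ℂ} (hw : Integrable w) (hu : Integrable u)
    {K : ℝ} (hK : ∀ X Y : ℝ,
      ‖∫ q : ℝ × ℝ, cexp (I * ((X * q.1 + Y * q.2 : ℝ) : ℂ)) * w q‖ ≤ K) (x y : ℝ) :
    ‖∫ q : ℝ × ℝ, cexp (I * ((x * q.1 + y * q.2 : ℝ) : ℂ)) * w q *
      ∫ p : ℝ × ℝ, cexp (-I * ((p.1 * q.1 + p.2 * q.2 : ℝ) : ℂ)) * u p‖ ≤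
      K * ∫ p : ℝ × ℝ, ‖u p‖ := by
  have hF : Integrable (Function.uncurry fun q p : ℝ × ℝ =>
      cexp (I * (((x - p.1) * q.1 + (y - p.2) * q.2 : ℝ) : ℂ)) * (w q * u p))
      (volume.prod volume) :=
    (hw.mul_prod hu).bdd_mul (c := 1) (Continuous.aestronglyMeasurable (by fun_prop))
      (ae_of_all _ fun q => (norm_cexp_I_mul_ofReal _).le)
  have h1 : ∀ q : ℝ × ℝ, cexp (I * ((x * q.1 + y * q.2 : ℝ) : ℂ)) * w q *
      ∫ p : ℝ × ℝ, cexp (-I * ((p.1 * q.1 + p.2 * q.2 : ℝ) : ℂ)) * u p =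
      ∫ p : ℝ × ℝ, cexp (I * (((x - p.1) * q.1 + (y - p.2) * q.2 : ℝ) : ℂ)) * (w q * u p) := by
    intro q
    rw [← integral_const_mul]
    refine integral_congr_ae (ae_of_all _ fun p => ?_)
    have : cexp (I * (((x - p.1) * q.1 + (y - p.2) * q.2 : ℝ) : ℂ)) =
        cexp (I * ((x * q.1 + y * q.2 : ℝ) : ℂ)) *
          cexp (-I * ((p.1 * q.1 + p.2 * q.2 : ℝ) : ℂ)) := by
      rw [← Complex.exp_add]
      congr 1
      push_cast
      ring
    simp only [this]
    ring
  simp only [h1]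
  rw [integral_integral_swap hF, ← integral_const_mul]
  refine norm_integral_le_of_norm_le (hu.norm.const_mul K) (ae_of_all _ fun p => ?_)
  simp only [← mul_assoc]
  rw [integral_mul_const, norm_mul]
  gcongr
  exact hK _ _

/-- Dispersive decay estimate: for `4/3 < α ≤ 6`, `θ = 1 - α/2`, there is a
constant `C > 0` depending only on `α` such that for all `κ`, every Schwartz
function `u₀` on `ℝ²`, every `t ≠ 0` and every `(x,y)`,
`|∫ e^{i(xξ+yη)} |ξ|^{-θ} e^{iκ log|ξ|} e^{it(ξ|ξ|^α - η²/ξ)} û₀(ξ,η) dξdη|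
  ≤ C ⟨κ⟩ |t|⁻¹ ‖u₀‖_{L¹}`. -/
theorem dispersive_decay_estimate (α : ℝ) (hα1 : 4 / 3 < α) (hα2 : α ≤ 6) :
    ∃ C > 0, ∀ (κ : ℝ) (u₀ : SchwartzMap (ℝ × ℝ) ℂ) (t x y : ℝ), t ≠ 0 →
      ‖∫ q : ℝ × ℝ,
          Complex.exp (Complex.I * ((x * q.1 + y * q.2 : ℝ) : ℂ)) *
          ((|q.1| ^ (-(1 - α / 2)) : ℝ) : ℂ) *
          Complex.exp (Complex.I * ((κ * Real.log |q.1| : ℝ) : ℂ)) *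
          Complex.exp (Complex.I * ((t * (q.1 * |q.1| ^ α - q.2 ^ 2 / q.1) : ℝ) : ℂ)) *
          (∫ p : ℝ × ℝ,
            Complex.exp (-Complex.I * ((p.1 * q.1 + p.2 * q.2 : ℝ) : ℂ)) * u₀ p)‖
        ≤ C * Real.sqrt (1 + κ ^ 2) * |t|⁻¹ * ∫ p : ℝ × ℝ, ‖u₀ p‖ := by
  refine ⟨20 * √π, by positivity, fun κ u₀ t x y ht => ?_⟩
  have hα : 1 < α := by linarith
  set F : ℝ × ℝ → ℂ := fun q =>
    Complex.exp (Complex.I * ((x * q.1 + y * q.2 : ℝ) : ℂ)) *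
      ((|q.1| ^ (-(1 - α / 2)) : ℝ) : ℂ) *
      Complex.exp (Complex.I * ((κ * Real.log |q.1| : ℝ) : ℂ)) *
      Complex.exp (Complex.I * ((t * (q.1 * |q.1| ^ α - q.2 ^ 2 / q.1) : ℝ) : ℂ)) *
      (∫ p : ℝ × ℝ,
        Complex.exp (-Complex.I * ((p.1 * q.1 + p.2 * q.2 : ℝ) : ℂ)) * u₀ p) with hF
  by_cases hFi : Integrable F
  swap
  · rw [integral_undef hFi, norm_zero]
    have : 0 ≤ ∫ p : ℝ × ℝ, ‖u₀ p‖ := integral_nonneg fun _ => norm_nonneg _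
    positivity
  set d : ℕ → ℝ := fun n => 1 / ((n : ℝ) + 1) with hd
  have hd0 : ∀ n, 0 < d n := fun n => Nat.one_div_pos_of_nat
  have hdlim : Filter.Tendsto d Filter.atTop (nhds 0) := tendsto_one_div_add_atTop_nhds_zero_nat
  set χ : ℕ → ℝ × ℝ → ℂ := fun n => {q : ℝ × ℝ | |q.1| ∈ Set.Ioc (d n) ((n : ℝ) + 1)}.indicator
    fun q => ((Real.exp (-(d n * q.2 ^ 2 / |q.1|)) : ℝ) : ℂ) with hχ
  have hχF : ∀ n q, χ n q * F q = cexp (I * ((x * q.1 + y * q.2 : ℝ) : ℂ)) *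
      dampedSymbol α κ t (d n) (d n) ((n : ℝ) + 1) q *
      ∫ p : ℝ × ℝ, cexp (-I * ((p.1 * q.1 + p.2 * q.2 : ℝ) : ℂ)) * u₀ p := by
    intro n q
    by_cases hq : |q.1| ∈ Set.Ioc (d n) ((n : ℝ) + 1)
    · simp only [hχ, hF, dampedSymbol]
      rw [Set.indicator_of_mem (by exact hq), Set.indicator_of_mem (by exact hq)]
      ring
    · simp only [hχ, hF, dampedSymbol]
      rw [Set.indicator_of_notMem (by exact hq), Set.indicator_of_notMem (by exact hq)]
      ring
  have hlim : Filter.Tendsto (fun n => ∫ q, χ n q * F q) Filter.atTop (nhds (∫ q, F q)) := by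
    refine tendsto_integral_of_dominated_convergence (fun q => ‖F q‖) (fun n => ?_) hFi.norm
      (fun n => ae_of_all _ fun q => ?_) ?_
    · refine AEStronglyMeasurable.mul (Measurable.aestronglyMeasurable ?_) hFi.1
      exact Measurable.indicator (by fun_prop) (measurableSet_abs_fst_mem_Ioc _ _)
    · rw [norm_mul]
      refine mul_le_of_le_one_left (norm_nonneg _) ?_
      by_cases hq : |q.1| ∈ Set.Ioc (d n) ((n : ℝ) + 1)
      · simp only [hχ]
        rw [Set.indicator_of_mem (by exact hq), Complex.norm_real, Real.norm_eq_abs, Real.abs_exp,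
          Real.exp_le_one_iff, neg_nonpos]
        have := (hd0 n).le
        positivity
      · simp only [hχ]
        rw [Set.indicator_of_notMem (by exact hq), norm_zero]
        exact zero_le_one
    · have hne : ∀ᵐ q : ℝ × ℝ, q.1 ≠ 0 :=
        Measure.quasiMeasurePreserving_fst.ae (Measure.ae_ne volume (0 : ℝ))
      filter_upwards [hne] with q hq
      have hq0 : 0 < |q.1| := abs_pos.2 hq
      have hev : ∀ᶠ n : ℕ in Filter.atTop,
          χ n q = ((Real.exp (-(d n * q.2 ^ 2 / |q.1|)) : ℝ) : ℂ) := by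
        filter_upwards [hdlim.eventually_lt_const hq0,
          tendsto_natCast_atTop_atTop.eventually_ge_atTop |q.1|] with n h1 h2
        simp only [hχ]
        rw [Set.indicator_of_mem (by exact ⟨h1, by linarith⟩)]
      have hχ1 : Filter.Tendsto (fun n => χ n q) Filter.atTop (nhds 1) := by
        refine Filter.Tendsto.congr' (hev.mono fun n h => h.symm) ?_
        have : Filter.Tendsto (fun n => -(d n * q.2 ^ 2 / |q.1|)) Filter.atTop (nhds 0) := by
          simpa using ((hdlim.mul_const (q.2 ^ 2)).div_const |q.1|).neg
        have h2 := (Complex.continuous_ofReal.tendsto _).comp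
          ((Real.continuous_exp.tendsto 0).comp this)
        simpa [Function.comp_def] using h2
      simpa using hχ1.mul_const (F q)
  refine le_of_tendsto' hlim.norm fun n => ?_
  have hab : d n ≤ (n : ℝ) + 1 := by
    have hn : (1 : ℝ) ≤ (n : ℝ) + 1 := by linarith [n.cast_nonneg (α := ℝ)]
    exact (div_le_one (by positivity)).2 hn |>.trans hn
  simp only [hχF]
  exact norm_integral_mul_fourier_le (integrable_dampedSymbol α κ t (hd0 n) (hd0 n) hab)
    u₀.integrable (fun X Y => norm_integral_dampedSymbol_le hα κ X Y ht (hd0 n) (hd0 n) hab) x y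
end
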